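/- arXiv:1110.6481 — 14 statements merged into one kernel-verified Lean document; each statement's English description precedes it below -/
import Mathlib

section
/- Fix a prime power q, the finite field F = F_q with q elements, n ≥ 1, an index i ∈ {1,…,n}, and a, b ∈ F. A function f : Fⁿ → F is ⟨i:a:b⟩ canalyzing if and only if there exists a function Q : Fⁿ → F such that f(x₁,…,x_n) = (x_i − a)·Q(x₁,…,x_n) + b for all (x₁,…,x_n) ∈ Fⁿ. -/
/-- `f` is `⟨i:a:b⟩` canalyzing: setting the `i`-th input to `a` forces output `b`. -/
def IsCanalyzing {F : Type*} {n : ℕ} (f : (Fin n → F) → F) (i : Fin n) (a b : F) : Prop :=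
  ∀ x : Fin n → F, f (Function.update x i a) = b

theorem stmt_2 {q n : ℕ} (hq : IsPrimePow q) (hn : 1 ≤ n)
    (F : Type*) [Field F] [Fintype F] (hcard : Fintype.card F = q)
    (i : Fin n) (a b : F) (f : (Fin n → F) → F) :
    IsCanalyzing f i a b ↔
      ∃ Q : (Fin n → F) → F, ∀ x : Fin n → F, f x = (x i - a) * Q x + b := by
  constructor
  · intro h
    refine ⟨fun x => (f x - b) / (x i - a), fun x => ?_⟩
    by_cases hx : x i = a
    · have h1 := h x
      rw [← hx, Function.update_eq_self] at h1
      simp [h1, hx]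
    · have h2 : x i - a ≠ 0 := sub_ne_zero.mpr hx
      rw [mul_div_cancel₀ _ h2]
      ring
  · rintro ⟨Q, hQ⟩ x
    rw [hQ]
    simp
end

section
/- Fix a prime power q, the finite field F = F_q with q elements, n ≥ 1, an index i ∈ {1,…,n}, an element b ∈ F, and k pairwise distinct elements a₁,…,a_k ∈ F (1 ≤ k ≤ q). The number of functions f : Fⁿ → F that are ⟨i:a_j:b⟩ canalyzing for every j = 1,…,k equals q^(qⁿ − k·q^(n−1)), i.e. |⋂_{j=1}^k C^i_{a_j,b}| = q^(qⁿ − k·q^(n−1)). -/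
theorem stmt_5 {q n k : ℕ} (hq : IsPrimePow q) (hn : 1 ≤ n)
    (hk1 : 1 ≤ k) (hkq : k ≤ q)
    (F : Type*) [Field F] [Fintype F] (hcard : Fintype.card F = q)
    (i : Fin n) (b : F) (a : Fin k → F) (ha : Function.Injective a) :
    Set.ncard {f : (Fin n → F) → F | ∀ j : Fin k, IsCanalyzing f i (a j) b} =
      q ^ (q ^ n - k * q ^ (n - 1)) := by
  classical
  have hS : (Finset.univ.image a).card = k := by
    rw [Finset.card_image_of_injective _ ha]; simp
  set S : Finset F := Finset.univ.image a with hSdef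
  have h1 : {f : (Fin n → F) → F | ∀ j : Fin k, IsCanalyzing f i (a j) b} =
      ((Fintype.piFinset (fun x : Fin n → F =>
        if x i ∈ S then ({b} : Finset F) else Finset.univ) : Finset ((Fin n → F) → F)) :
        Set ((Fin n → F) → F)) := by
    ext f
    simp only [Set.mem_setOf_eq, Finset.mem_coe, Fintype.mem_piFinset]
    constructor
    · intro h x
      split_ifs with hx
      · obtain ⟨j, -, hj⟩ := Finset.mem_image.mp hx
        have := h j x
        rw [hj, Function.update_eq_self] at this
        simpa using this
      · simp
    · intro h j x
      have := h (Function.update x i (a j))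
      simpa [hSdef] using this
  have h2 : (Finset.univ.filter (fun x : Fin n → F => x i ∈ S)).card = k * q ^ (n - 1) := by
    have : Finset.univ.filter (fun x : Fin n → F => x i ∈ S) =
        Fintype.piFinset (fun j => if j = i then S else Finset.univ) := by
      ext x
      simp only [Finset.mem_filter, Finset.mem_univ, true_and, Fintype.mem_piFinset]
      constructor
      · intro h j
        split_ifs with hj
        · rwa [hj]
        · simp
      · intro h
        simpa using h i
    rw [this, Fintype.card_piFinset, ← Finset.mul_prod_erase _ _ (Finset.mem_univ i)]
    rw [Finset.prod_congr rfl (g := fun _ => q)]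
    · simp [hS]
    · intro j hj
      rw [if_neg (Finset.ne_of_mem_erase hj), Finset.card_univ, hcard]
  have h3 : (Finset.univ.filter (fun x : Fin n → F => ¬ x i ∈ S)).card
      = q ^ n - k * q ^ (n - 1) := by
    have h := Finset.card_filter_add_card_filter_not (s := (Finset.univ : Finset (Fin n → F)))
      (fun x : Fin n → F => x i ∈ S)
    rw [h2, Finset.card_univ, Fintype.card_fun, hcard, Fintype.card_fin] at h
    omega
  rw [h1, Set.ncard_coe_finset, Fintype.card_piFinset, ← h3]
  simp only [apply_ite Finset.card, Finset.card_singleton, Finset.card_univ, hcard]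
  rw [Finset.prod_ite]
  simp
end

section
/- Fix a prime power q, the finite field F = F_q with q elements, n ≥ 1, an index i ∈ {1,…,n}, and b ∈ F. The number of functions f : Fⁿ → F that are ⟨i:a:b⟩ canalyzing for some a ∈ F equals q^(qⁿ) − (q^(q^(n−1)) − 1)^q, i.e. |C^i_{*,b}| = q^(qⁿ) − (q^(q^(n−1)) − 1)^q. -/
theorem stmt_6 {q n : ℕ} (hq : IsPrimePow q) (hn : 1 ≤ n)
    (F : Type*) [Field F] [Fintype F] (hcard : Fintype.card F = q)
    (i : Fin n) (b : F) :
    Set.ncard {f : (Fin n → F) → F | ∃ a : F, IsCanalyzing f i a b} =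
      q ^ (q ^ n) - (q ^ (q ^ (n - 1)) - 1) ^ q := by
  classical
  obtain ⟨m, rfl⟩ : ∃ m, n = m + 1 := ⟨n - 1, by omega⟩
  let e : ((Fin (m + 1) → F) → F) ≃ (F → ((Fin m → F) → F)) :=
    (Equiv.arrowCongr (Fin.insertNthEquiv (fun _ => F) i).symm (Equiv.refl F)).trans
      (Equiv.curry F (Fin m → F) F)
  have he : ∀ f a y, e f a y = f (i.insertNth a y) := fun f a y => rfl
  have hiff : ∀ f a, IsCanalyzing f i a b ↔ e f a = fun _ => b := by
    intro f a
    constructor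
    · intro h
      funext y
      have := h (i.insertNth a y)
      rw [Fin.update_insertNth] at this
      rw [he, this]
    · intro h x
      have := congrFun h (i.removeNth x)
      rw [he] at this
      rw [← this, Fin.insertNth_removeNth]
  set S : Set ((Fin (m + 1) → F) → F) := {f | ∃ a : F, IsCanalyzing f i a b} with hS
  have hc : Sᶜ.ncard = (q ^ (q ^ m) - 1) ^ q := by
    have h1 : e '' Sᶜ = ((Fintype.piFinset fun _ : F =>
        ({fun _ => b}ᶜ : Finset ((Fin m → F) → F)) : Finset (F → ((Fin m → F) → F))) :
        Set (F → ((Fin m → F) → F))) := by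
      ext g
      obtain ⟨f, rfl⟩ := e.surjective g
      simp [hS, hiff]
    rw [← Set.ncard_image_of_injective _ e.injective, h1, Set.ncard_coe_finset,
      Fintype.card_piFinset]
    simp [Finset.card_compl, hcard]
  have ht := Set.ncard_add_ncard_compl S
  have hN : Nat.card ((Fin (m + 1) → F) → F) = q ^ (q ^ (m + 1)) := by
    simp [Nat.card_eq_fintype_card, hcard]
  rw [hc, hN] at ht
  rw [Nat.add_sub_cancel]
  omega
end

section
/- Fix a prime power q, the finite field F = F_q with q elements, n ≥ 1, elements a, b ∈ F, and k pairwise distinct indices i₁,…,i_k ∈ {1,…,n} (1 ≤ k ≤ n). The number of functions f : Fⁿ → F that are ⟨i_j:a:b⟩ canalyzing for every j = 1,…,k equals q^((q−1)^k · q^(n−k)), i.e. |⋂_{j=1}^k C^{i_j}_{a,b}| = q^((q−1)^k · q^(n−k)). -/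
theorem stmt_7 {q n k : ℕ} (hq : IsPrimePow q) (hn : 1 ≤ n)
    (hk1 : 1 ≤ k) (hkn : k ≤ n)
    (F : Type*) [Field F] [Fintype F] (hcard : Fintype.card F = q)
    (a b : F) (i : Fin k → Fin n) (hi : Function.Injective i) :
    Set.ncard {f : (Fin n → F) → F | ∀ j : Fin k, IsCanalyzing f (i j) a b} =
      q ^ ((q - 1) ^ k * q ^ (n - k)) := by
  classical
  subst hcard
  have h1 : {f : (Fin n → F) → F | ∀ j : Fin k, IsCanalyzing f (i j) a b} =
      ((Fintype.piFinset (fun x : Fin n → F =>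
        if ∀ j, x (i j) ≠ a then (Finset.univ : Finset F) else {b}) :
        Finset ((Fin n → F) → F)) : Set ((Fin n → F) → F)) := by
    ext f
    simp only [Set.mem_setOf_eq, Finset.mem_coe, Fintype.mem_piFinset]
    constructor
    · intro h x
      split_ifs with hx
      · simp
      · push Not at hx
        obtain ⟨j, hj⟩ := hx
        have := h j x
        rw [← hj, Function.update_eq_self] at this
        simp [this]
    · intro h j x
      have := h (Function.update x (i j) a)
      rw [if_neg] at this
      · simpa using this
      · intro h'
        exact h' j (by simp)
  have h2 : (Finset.univ.filter (fun x : Fin n → F => ∀ j, x (i j) ≠ a)) =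
      Fintype.piFinset (fun m : Fin n =>
        if m ∈ Finset.univ.image i then ({a}ᶜ : Finset F) else Finset.univ) := by
    ext x
    simp only [Finset.mem_filter, Finset.mem_univ, true_and, Fintype.mem_piFinset]
    constructor
    · intro h m
      split_ifs with hm
      · obtain ⟨j, -, rfl⟩ := Finset.mem_image.mp hm
        simpa using h j
      · simp
    · intro h j
      have := h (i j)
      rw [if_pos (Finset.mem_image_of_mem i (Finset.mem_univ j))] at this
      simpa using this
  have h3 : (Finset.univ.image i).card = k := by
    rw [Finset.card_image_of_injective _ hi]; simp
  have h4 : (Finset.univ.filter (fun x : Fin n → F => ∀ j, x (i j) ≠ a)).card =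
      (Fintype.card F - 1) ^ k * Fintype.card F ^ (n - k) := by
    rw [h2, Fintype.card_piFinset]
    simp only [apply_ite Finset.card, Finset.card_compl, Finset.card_singleton, Finset.card_univ]
    rw [Finset.prod_ite, Finset.prod_const, Finset.prod_const, Finset.filter_not,
      Finset.filter_mem_eq_inter, Finset.univ_inter, Finset.card_sdiff_of_subset
      (Finset.subset_univ _), h3, Finset.card_univ, Fintype.card_fin]
  rw [h1, Set.ncard_coe_finset, Fintype.card_piFinset]
  simp only [apply_ite Finset.card, Finset.card_singleton, Finset.card_univ]
  rw [Finset.prod_ite, Finset.prod_const, Finset.prod_const, one_pow, mul_one, h4]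
end

section
/- Fix a prime power q, the finite field F = F_q with q elements, n ≥ 1, and a, b ∈ F. The number of functions f : Fⁿ → F that are ⟨i:a:b⟩ canalyzing for some index i ∈ {1,…,n} equals Σ_{k=1}^{n} (−1)^(k−1) · C(n,k) · q^((q−1)^k · q^(n−k)), where C(n,k) is the binomial coefficient; i.e. |C^*_{a,b}| = Σ_{k=1}^{n} (−1)^(k−1) C(n,k) q^((q−1)^k q^(n−k)). -/
open Classical in
lemma card_avoid {F : Type*} [Fintype F] {n : ℕ} (a : F) (t : Finset (Fin n)) :
    (Finset.univ.filter (fun y : Fin n → F => ¬ ∃ i ∈ t, y i = a)).card =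
      (Fintype.card F - 1) ^ t.card * Fintype.card F ^ (n - t.card) := by
  have h : (Finset.univ.filter (fun y : Fin n → F => ¬ ∃ i ∈ t, y i = a)) =
      Fintype.piFinset (fun i => if i ∈ t then ({a}ᶜ : Finset F) else Finset.univ) := by
    ext y
    simp only [Finset.mem_filter, Finset.mem_univ, true_and, Fintype.mem_piFinset, not_exists,
      not_and]
    refine forall_congr' fun i => ?_
    by_cases hi : i ∈ t <;> simp [hi]
  rw [h, Fintype.card_piFinset]
  have h2 : ∀ i, (if i ∈ t then ({a}ᶜ : Finset F) else Finset.univ).card =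
      if i ∈ t then Fintype.card F - 1 else Fintype.card F := by
    intro i
    split_ifs <;> simp [Finset.card_compl]
  simp only [h2]
  rw [Finset.prod_ite, Finset.prod_const, Finset.prod_const]
  have h3 : Finset.univ.filter (fun i => i ∉ t) = tᶜ := by ext; simp
  rw [h3, Finset.card_compl]
  simp

open Classical in
lemma card_canal {F : Type*} [Fintype F] {n : ℕ} (a b : F) (t : Finset (Fin n)) :
    (Finset.univ.filter (fun f : (Fin n → F) → F => ∀ i ∈ t, IsCanalyzing f i a b)).card =
      Fintype.card F ^ ((Fintype.card F - 1) ^ t.card * Fintype.card F ^ (n - t.card)) := by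
  have h : (Finset.univ.filter (fun f : (Fin n → F) → F => ∀ i ∈ t, IsCanalyzing f i a b)) =
      Fintype.piFinset (fun y : Fin n → F =>
        if ∃ i ∈ t, y i = a then ({b} : Finset F) else Finset.univ) := by
    ext f
    simp only [Finset.mem_filter, Finset.mem_univ, true_and, Fintype.mem_piFinset]
    constructor
    · intro hf y
      split_ifs with hy
      · obtain ⟨i, hi, hya⟩ := hy
        have := hf i hi y
        rw [← hya, Function.update_eq_self] at this
        simpa using this
      · simp
    · intro hf i hi x
      have := hf (Function.update x i a)
      rw [if_pos ⟨i, hi, by simp⟩] at this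
      simpa using this
  rw [h, Fintype.card_piFinset]
  have h2 : ∀ y : Fin n → F,
      (if ∃ i ∈ t, y i = a then ({b} : Finset F) else Finset.univ).card =
      if ∃ i ∈ t, y i = a then 1 else Fintype.card F := by
    intro i
    split_ifs <;> simp
  simp only [h2]
  rw [Finset.prod_ite, Finset.prod_const, Finset.prod_const, one_pow, one_mul, card_avoid]

theorem stmt_8 {q n : ℕ} (hq : IsPrimePow q) (hn : 1 ≤ n)
    (F : Type*) [Field F] [Fintype F] (hcard : Fintype.card F = q)
    (a b : F) :
    (Set.ncard {f : (Fin n → F) → F | ∃ i : Fin n, IsCanalyzing f i a b} : ℤ) =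
      ∑ k ∈ Finset.Icc 1 n,
        (-1 : ℤ) ^ (k - 1) * (n.choose k : ℤ) * (q : ℤ) ^ ((q - 1) ^ k * q ^ (n - k)) := by
  classical
  have h1 : {f : (Fin n → F) → F | ∃ i : Fin n, IsCanalyzing f i a b} =
      (((Finset.univ : Finset (Fin n)).biUnion
        (fun i => Finset.univ.filter (fun f : (Fin n → F) → F => IsCanalyzing f i a b)) :
          Finset ((Fin n → F) → F)) : Set ((Fin n → F) → F)) := by
    ext f; simp
  rw [h1, Set.ncard_coe_finset, Finset.inclusion_exclusion_card_biUnion]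
  let g : ℕ → ℤ := fun k => if k = 0 then 0 else
    (-1 : ℤ) ^ (k - 1) * (q : ℤ) ^ ((q - 1) ^ k * q ^ (n - k))
  have h2 : ∀ (t : Finset (Fin n)) (hne : t.Nonempty),
      (-1 : ℤ) ^ (t.card + 1) * ((t.inf' hne
        (fun i => Finset.univ.filter
          (fun f : (Fin n → F) → F => IsCanalyzing f i a b))).card : ℤ) = g t.card := by
    intro t hne
    have h3 : t.inf' hne (fun i => Finset.univ.filter
          (fun f : (Fin n → F) → F => IsCanalyzing f i a b)) =
        Finset.univ.filter (fun f : (Fin n → F) → F => ∀ i ∈ t, IsCanalyzing f i a b) := by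
      ext f
      rw [Finset.inf'_eq_inf, Finset.mem_inf]
      simp
    have hc : t.card ≠ 0 := by simpa using hne.ne_empty
    obtain ⟨m, hm⟩ := Nat.exists_eq_succ_of_ne_zero hc
    simp only [h3, card_canal, g, if_neg hc, hcard, hm]
    simp [pow_succ]
  rw [Finset.sum_congr rfl (fun t _ => h2 t.1 _),
    Finset.sum_coe_sort _ (fun t : Finset (Fin n) => g t.card), Finset.sum_filter]
  have h4 : ∀ t : Finset (Fin n), (if t.Nonempty then g t.card else 0) = g t.card := by
    intro t
    rcases t.eq_empty_or_nonempty with rfl | h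
    · simp [g]
    · simp [h]
  simp only [h4]
  rw [Finset.sum_powerset_apply_card, Finset.card_univ, Fintype.card_fin,
    Finset.range_eq_Ico, Finset.sum_eq_sum_Ico_succ_bot (by omega)]
  have h5 : Finset.Ico (0 + 1) (n + 1) = Finset.Icc 1 n := by ext; simp <;> omega
  rw [h5]
  simp only [g, if_true, smul_zero, zero_add]
  refine Finset.sum_congr rfl fun k hk => ?_
  have hk0 : k ≠ 0 := by have := (Finset.mem_Icc.1 hk).1; omega
  rw [if_neg hk0, nsmul_eq_mul]
  ring
end

section
/- Fix a prime power q, the finite field F = F_q with q elements, n ≥ 1, and a ∈ F. The number of functions f : Fⁿ → F that are ⟨i:a:b⟩ canalyzing for some index i ∈ {1,…,n} and some b ∈ F equals q · Σ_{k=1}^{n} (−1)^(k−1) · C(n,k) · q^((q−1)^k · q^(n−k)); i.e. |C^*_{a,*}| = q Σ_{k=1}^{n} (−1)^(k−1) C(n,k) q^((q−1)^k q^(n−k)). -/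
open Finset in
theorem card_avoid_aux {n : ℕ} (F : Type*) [Fintype F] [DecidableEq F] (a : F)
    (t : Finset (Fin n)) :
    Fintype.card {x : Fin n → F // ∀ i ∈ t, x i ≠ a} =
      (Fintype.card F - 1) ^ #t * Fintype.card F ^ (n - #t) := by
  classical
  rw [Fintype.card_subtype]
  have h : (univ.filter fun x : Fin n → F => ∀ i ∈ t, x i ≠ a) =
      Fintype.piFinset (fun i => if i ∈ t then univ.erase a else univ) := by
    ext x
    simp only [mem_filter, mem_univ, true_and, Fintype.mem_piFinset]
    refine forall_congr' fun i => ?_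
    by_cases hi : i ∈ t <;> simp [hi]
  rw [h, Fintype.card_piFinset]
  have h2 : ∀ i : Fin n, #(if i ∈ t then (univ : Finset F).erase a else univ) =
      if i ∈ t then Fintype.card F - 1 else Fintype.card F := by
    intro i
    split_ifs <;> simp [card_erase_of_mem]
  simp only [h2]
  rw [prod_ite, prod_const, prod_const]
  have h3 : (univ.filter fun i => i ∈ t) = t := by ext; simp
  have h4 : (univ.filter fun i => i ∉ t) = tᶜ := by ext; simp
  rw [h3, h4, card_compl, Fintype.card_fin]

open Finset Classical in
theorem card_inter_aux {n : ℕ} (F : Type*) [Fintype F] (a : F)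
    (t : Finset (Fin n)) (ht : t.Nonempty) :
    #(t.inf' ht fun i => univ.filter fun f : (Fin n → F) → F => ∃ b, IsCanalyzing f i a b) =
      Fintype.card F * Fintype.card F ^
        ((Fintype.card F - 1) ^ #t * Fintype.card F ^ (n - #t)) := by
  let Φ : F × ({x : Fin n → F // ∀ i ∈ t, x i ≠ a} → F) → ((Fin n → F) → F) :=
    fun p x => if h : ∀ i ∈ t, x i ≠ a then p.2 ⟨x, h⟩ else p.1
  have hinj : Function.Injective Φ := by
    rintro ⟨b, g⟩ ⟨b', g'⟩ h
    obtain ⟨i, hi⟩ := ht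
    have h1 := congrFun h (fun _ => a)
    have hn : ¬ ∀ j ∈ t, (fun _ : Fin n => a) j ≠ a := fun hh => hh i hi rfl
    simp only [Φ, dif_neg hn] at h1
    refine Prod.ext h1 ?_
    funext ⟨x, hx⟩
    have h2 := congrFun h x
    simp only [Φ, dif_pos hx] at h2
    exact h2
  have himg : (t.inf' ht fun i =>
      univ.filter fun f : (Fin n → F) → F => ∃ b, IsCanalyzing f i a b) = univ.image Φ := by
    ext f
    rw [Finset.mem_inf']
    simp only [mem_filter, mem_univ, true_and, mem_image]
    constructor
    · intro h
      refine ⟨(f fun _ => a, fun x => f x.1), ?_⟩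
      funext x
      by_cases hx : ∀ i ∈ t, x i ≠ a
      · simp only [Φ, dif_pos hx]
      · simp only [Φ, dif_neg hx]
        push Not at hx
        obtain ⟨i, hi, hxi⟩ := hx
        obtain ⟨b, hb⟩ := h i hi
        have e1 := hb x
        have e2 := hb (fun _ => a)
        rw [Function.update_eq_self_iff.2 hxi.symm] at e1
        rw [Function.update_eq_self_iff.2 rfl] at e2
        rw [e1, e2]
    · rintro ⟨⟨b, g⟩, rfl⟩ i hi
      refine ⟨b, fun x => ?_⟩
      have hn : ¬ ∀ j ∈ t, Function.update x i a j ≠ a := fun hh => hh i hi (by simp)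
      simp only [Φ, dif_neg hn]
  rw [himg, card_image_of_injective _ hinj, card_univ, Fintype.card_prod, Fintype.card_fun]
  congr 2
  convert card_avoid_aux F a t

open Finset Classical in
theorem stmt_9_aux {n : ℕ} (F : Type*) [Fintype F] (a : F) :
    (Set.ncard {f : (Fin n → F) → F | ∃ i : Fin n, ∃ b : F, IsCanalyzing f i a b} : ℤ) =
      (Fintype.card F : ℤ) * ∑ k ∈ Finset.Icc 1 n,
        (-1 : ℤ) ^ (k - 1) * (n.choose k : ℤ) *
          (Fintype.card F : ℤ) ^ ((Fintype.card F - 1) ^ k * Fintype.card F ^ (n - k)) := by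
  set q := Fintype.card F with hq
  have h0 : {f : (Fin n → F) → F | ∃ i : Fin n, ∃ b : F, IsCanalyzing f i a b} =
      ((univ.biUnion fun i : Fin n =>
        univ.filter fun f : (Fin n → F) → F => ∃ b, IsCanalyzing f i a b :
          Finset ((Fin n → F) → F)) : Set ((Fin n → F) → F)) := by
    ext f; simp
  rw [h0, Set.ncard_coe_finset, inclusion_exclusion_card_biUnion]
  simp only [card_inter_aux]
  rw [Finset.sum_coe_sort ((univ : Finset (Fin n)).powerset.filter (·.Nonempty))
    (fun t => (-1 : ℤ) ^ (#t + 1) * ((q * q ^ ((q - 1) ^ #t * q ^ (n - #t)) : ℕ) : ℤ)),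
    Finset.sum_filter]
  have h1 : ∀ t ∈ (univ : Finset (Fin n)).powerset,
      (if t.Nonempty then
        (-1 : ℤ) ^ (#t + 1) * ((q * q ^ ((q - 1) ^ #t * q ^ (n - #t)) : ℕ) : ℤ) else 0) =
      (fun k => if 0 < k then
        (-1 : ℤ) ^ (k + 1) * ((q * q ^ ((q - 1) ^ k * q ^ (n - k)) : ℕ) : ℤ) else 0) #t := by
    intro t _
    simp only [Finset.card_pos]
  rw [sum_congr rfl h1, sum_powerset_apply_card (fun k => if 0 < k then
        (-1 : ℤ) ^ (k + 1) * ((q * q ^ ((q - 1) ^ k * q ^ (n - k)) : ℕ) : ℤ) else 0), card_univ, Fintype.card_fin,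
    Finset.sum_range_succ', mul_sum]
  have h2 : Icc 1 n = (range n).image (· + 1) := by
    ext k
    simp only [mem_Icc, mem_image, mem_range]
    exact ⟨fun h => ⟨k - 1, by omega, by omega⟩, by rintro ⟨j, hj, rfl⟩; omega⟩
  rw [h2, sum_image (by intro x _ y _ h; simpa using h)]
  simp only [lt_irrefl, if_false, smul_zero, add_zero]
  refine sum_congr rfl fun k _ => ?_
  simp only [Nat.succ_pos, if_true, Nat.add_sub_cancel, nsmul_eq_mul]
  push_cast
  ring

theorem stmt_9 {q n : ℕ} (hq : IsPrimePow q) (hn : 1 ≤ n)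
    (F : Type*) [Field F] [Fintype F] (hcard : Fintype.card F = q)
    (a : F) :
    (Set.ncard {f : (Fin n → F) → F | ∃ i : Fin n, ∃ b : F, IsCanalyzing f i a b} : ℤ) =
      (q : ℤ) * ∑ k ∈ Finset.Icc 1 n,
        (-1 : ℤ) ^ (k - 1) * (n.choose k : ℤ) * (q : ℤ) ^ ((q - 1) ^ k * q ^ (n - k)) := by
  subst hcard
  exact stmt_9_aux F a
end

section
/- Fix a prime power q, the finite field F = F_q with q elements, n ≥ 1, and b ∈ F. For each j ∈ {1,…,n} let A_j ⊆ F be a subset with |A_j| = k_j, and assume not all A_j are empty. Then the number of functions f : Fⁿ → F such that, for every j ∈ {1,…,n} and every a ∈ A_j, f is ⟨j:a:b⟩ canalyzing, equals q^((q−k₁)(q−k₂)⋯(q−k_n)). -/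
theorem stmt_10 {q n : ℕ} (hq : IsPrimePow q) (hn : 1 ≤ n)
    (F : Type*) [Field F] [Fintype F] (hcard : Fintype.card F = q)
    (b : F) (A : Fin n → Finset F) (hA : ∃ j : Fin n, (A j).Nonempty) :
    Set.ncard {f : (Fin n → F) → F | ∀ j : Fin n, ∀ a ∈ A j, IsCanalyzing f j a b} =
      q ^ (∏ j : Fin n, (q - (A j).card)) := by
  classical
  have key : {f : (Fin n → F) → F | ∀ j : Fin n, ∀ a ∈ A j, IsCanalyzing f j a b} =
      ((Fintype.piFinset (fun x : Fin n → F =>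
        if x ∈ Fintype.piFinset (fun j => (A j)ᶜ) then (Finset.univ : Finset F) else {b}) :
        Finset ((Fin n → F) → F)) : Set ((Fin n → F) → F)) := by
    ext f
    simp only [Set.mem_setOf_eq, Finset.mem_coe]
    rw [Fintype.mem_piFinset]
    constructor
    · intro h x
      split_ifs with hx
      · exact Finset.mem_univ _
      · simp only [Fintype.mem_piFinset, Finset.mem_compl, not_forall, not_not] at hx
        obtain ⟨j, hj⟩ := hx
        have h1 := h j (x j) hj x
        rw [Function.update_eq_self] at h1
        exact Finset.mem_singleton.2 h1
    · intro h j a ha x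
      have h1 := h (Function.update x j a)
      rw [if_neg] at h1
      · exact Finset.mem_singleton.1 h1
      · intro hx
        have h2 := Fintype.mem_piFinset.1 hx j
        rw [Function.update_self, Finset.mem_compl] at h2
        exact h2 ha
  rw [key, Set.ncard_coe_finset, Fintype.card_piFinset]
  have h3 : ∀ x : Fin n → F,
      (if x ∈ Fintype.piFinset (fun j => (A j)ᶜ) then (Finset.univ : Finset F) else {b}).card
        = if x ∈ Fintype.piFinset (fun j => (A j)ᶜ) then q else 1 := by
    intro x
    split_ifs
    · rw [Finset.card_univ, hcard]
    · exact Finset.card_singleton b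
  rw [Finset.prod_congr rfl (fun x _ => h3 x), Finset.prod_ite_mem, Finset.univ_inter,
    Finset.prod_const, Fintype.card_piFinset]
  simp only [Finset.card_compl, hcard]
end

section
/- Fix a prime power q, the finite field F = F_q with q elements, n ≥ 1, and b ∈ F. The number of functions f : Fⁿ → F that are ⟨i:a:b⟩ canalyzing for some i ∈ {1,…,n} and some a ∈ F equals Σ_{k=1}^{nq} (−1)^(k−1) · Σ_{(k₁,…,k_n): k₁+⋯+k_n = k, 0 ≤ k_j ≤ q} (∏_{j=1}^{n} C(q,k_j)) · q^(∏_{j=1}^{n} (q − k_j)); i.e. |C^*_{*,b}| is given by this double sum. -/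
open Classical in
theorem count_aux {n : ℕ} {F : Type*} [Fintype F] (b : F) (T : Fin n → Finset F) :
    (Finset.univ.filter (fun f : (Fin n → F) → F =>
      ∀ j, ∀ a ∈ T j, IsCanalyzing f j a b)).card
      = Fintype.card F ^ (∏ j, (Fintype.card F - (T j).card)) := by
  have h : (Finset.univ.filter (fun f : (Fin n → F) → F =>
      ∀ j, ∀ a ∈ T j, IsCanalyzing f j a b)) =
      Fintype.piFinset (fun x : Fin n → F => if ∀ j, x j ∈ (T j)ᶜ then Finset.univ else {b}) := by
    ext f
    simp only [Finset.mem_filter, Finset.mem_univ, true_and, Fintype.mem_piFinset]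
    constructor
    · intro h x
      split_ifs with hx
      · simp
      · push Not at hx
        obtain ⟨j, hj⟩ := hx
        have := h j (x j) (by simpa using hj) x
        simpa using this
    · intro h j a ha x
      have := h (Function.update x j a)
      rw [if_neg] at this
      · simpa using this
      · intro hh
        have := hh j
        simp [ha] at this
  rw [h, Fintype.card_piFinset]
  have h2 : ∀ x : Fin n → F, (if ∀ j, x j ∈ (T j)ᶜ then Finset.univ else {b} : Finset F).card
      = if x ∈ Fintype.piFinset (fun j => (T j)ᶜ) then Fintype.card F else 1 := by
    intro x
    simp only [Fintype.mem_piFinset]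
    split_ifs <;> simp
  simp_rw [h2]
  rw [Finset.prod_ite_mem, Finset.univ_inter, Finset.prod_const, Fintype.card_piFinset]
  simp_rw [Finset.card_compl]

open Classical in
theorem group_aux {n : ℕ} {F : Type*} [Fintype F] (g : (Fin n → ℕ) → ℤ) :
    ∑ T : Fin n → Finset F, g (fun j => (T j).card) =
      ∑ v ∈ Fintype.piFinset (fun _ : Fin n => Finset.range (Fintype.card F + 1)),
        (∏ j, ((Fintype.card F).choose (v j) : ℤ)) * g v := by
  rw [← Finset.sum_fiberwise_of_maps_to (s := Finset.univ)
    (t := Fintype.piFinset (fun _ : Fin n => Finset.range (Fintype.card F + 1)))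
    (g := fun T : Fin n → Finset F => fun j => (T j).card)]
  · refine Finset.sum_congr rfl fun v _ => ?_
    rw [Finset.sum_congr rfl (g := fun _ => g v)]
    · rw [Finset.sum_const, nsmul_eq_mul]
      congr 1
      have : (Finset.univ.filter fun T : Fin n → Finset F => (fun j => (T j).card) = v)
          = Fintype.piFinset (fun j => Finset.powersetCard (v j) Finset.univ) := by
        ext T
        simp [funext_iff, Finset.mem_powersetCard]
      rw [this, Fintype.card_piFinset]
      simp
    · intro T hT
      rw [(Finset.mem_filter.1 hT).2]
  · intro T _
    simp only [Fintype.mem_piFinset, Finset.mem_range]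
    intro j
    exact Nat.lt_succ_of_le (Finset.card_le_univ _)

open Classical in
theorem incl_excl_aux {n : ℕ} {F : Type*} [Fintype F] (b : F) :
    ((Finset.univ.filter (fun f : (Fin n → F) → F =>
      ¬ ∃ i, ∃ a, IsCanalyzing f i a b)).card : ℤ)
      = ∑ T : Fin n → Finset F, (-1 : ℤ) ^ (∑ j, (T j).card) *
        (Fintype.card F : ℤ) ^ (∏ j, (Fintype.card F - (T j).card)) := by
  have h1 : ∀ f : (Fin n → F) → F,
      (if ¬ ∃ i, ∃ a, IsCanalyzing f i a b then (1 : ℤ) else 0) =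
      ∑ T : Fin n → Finset F, if ∀ j, ∀ a ∈ T j, IsCanalyzing f j a b then
        (-1 : ℤ) ^ (∑ j, (T j).card) else 0 := by
    intro f
    have e : (if ¬ ∃ i, ∃ a, IsCanalyzing f i a b then (1 : ℤ) else 0) =
        ∏ j, ∑ S ∈ (Finset.univ.filter fun a => IsCanalyzing f j a b).powerset,
          (-1 : ℤ) ^ S.card := by
      simp_rw [Finset.sum_powerset_neg_one_pow_card]
      by_cases h : ¬ ∃ i, ∃ a, IsCanalyzing f i a b
      · rw [if_pos h]
        symm
        apply Finset.prod_eq_one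
        intro j _
        rw [if_pos]
        ext a
        simp only [Finset.mem_filter, Finset.mem_univ, true_and, Finset.notMem_empty, iff_false]
        exact fun ha => h ⟨j, a, ha⟩
      · rw [if_neg h]
        push Not at h
        obtain ⟨j, a, ha⟩ := h
        symm
        apply Finset.prod_eq_zero (Finset.mem_univ j)
        rw [if_neg]
        intro h0
        have : a ∈ (Finset.univ.filter fun a => IsCanalyzing f j a b) := by simpa using ha
        simp [h0] at this
    rw [e, Finset.prod_univ_sum, ← Finset.sum_filter]
    refine Finset.sum_congr ?_ fun T _ => Finset.prod_pow_eq_pow_sum _ _ _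
    ext T
    simp [Finset.subset_iff]
  rw [Finset.card_filter]
  push_cast
  simp_rw [h1]
  rw [Finset.sum_comm]
  refine Finset.sum_congr rfl fun T _ => ?_
  rw [← Finset.sum_filter, Finset.sum_const, count_aux, nsmul_eq_mul, mul_comm]
  push_cast
  rfl

theorem stmt_11 {q n : ℕ} (hq : IsPrimePow q) (hn : 1 ≤ n)
    (F : Type*) [Field F] [Fintype F] (hcard : Fintype.card F = q)
    (b : F) :
    (Set.ncard {f : (Fin n → F) → F | ∃ i : Fin n, ∃ a : F, IsCanalyzing f i a b} : ℤ) =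
      ∑ k ∈ Finset.Icc 1 (n * q), (-1 : ℤ) ^ (k - 1) *
        ∑ v ∈ (Fintype.piFinset fun _ : Fin n => Finset.range (q + 1)) |>.filter
            (fun v => ∑ j : Fin n, v j = k),
          (∏ j : Fin n, (q.choose (v j) : ℤ)) * (q : ℤ) ^ (∏ j : Fin n, (q - v j)) := by
  classical
  have hc := incl_excl_aux (n := n) b
  rw [group_aux (F := F) (fun v => (-1 : ℤ) ^ (∑ j, v j) *
        (Fintype.card F : ℤ) ^ (∏ j, (Fintype.card F - v j))), hcard] at hc
  have hs : (Set.ncard {f : (Fin n → F) → F | ∃ i : Fin n, ∃ a : F, IsCanalyzing f i a b}) =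
      (Finset.univ.filter (fun f : (Fin n → F) → F =>
        ∃ i, ∃ a, IsCanalyzing f i a b)).card := by
    rw [← Set.ncard_coe_finset]
    simp
  have ht := Finset.card_filter_add_card_filter_not (s := Finset.univ)
    (fun f : (Fin n → F) → F => ∃ i, ∃ a, IsCanalyzing f i a b)
  have hu : (Finset.univ : Finset ((Fin n → F) → F)).card = q ^ q ^ n := by
    rw [Finset.card_univ]
    simp [hcard]
  rw [hu] at ht
  have ht' : ((Finset.univ.filter (fun f : (Fin n → F) → F =>
        ∃ i, ∃ a, IsCanalyzing f i a b)).card : ℤ) + ((Finset.univ.filter (fun f : (Fin n → F) → F =>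
      ¬ ∃ i, ∃ a, IsCanalyzing f i a b)).card : ℤ) = (q : ℤ) ^ q ^ n := by
    exact_mod_cast ht
  rw [hs]
  rw [hc] at ht'
  rw [← Finset.sum_fiberwise_of_maps_to (t := Finset.range (n * q + 1))
    (g := fun v : Fin n → ℕ => ∑ j, v j)] at ht'
  · rw [Finset.range_eq_Ico, Finset.sum_eq_sum_Ico_succ_bot (by omega)] at ht'
    have h0 : (Fintype.piFinset fun _ : Fin n => Finset.range (q + 1)).filter
        (fun v => ∑ j : Fin n, v j = 0) = {fun _ => 0} := by
      ext v
      simp only [Finset.mem_filter, Fintype.mem_piFinset, Finset.mem_range, Finset.sum_eq_zero_iff,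
        Finset.mem_univ, true_implies, Finset.mem_singleton, funext_iff]
      constructor
      · exact fun h => h.2
      · exact fun h => ⟨fun j => by rw [h j]; omega, h⟩
    rw [h0, Finset.sum_singleton] at ht'
    simp only [Nat.choose_zero_right, Nat.cast_one, Finset.prod_const_one, Finset.sum_const_zero,
      pow_zero, one_mul, Nat.sub_zero, Finset.prod_const, Finset.card_univ, Fintype.card_fin] at ht'
    have hIcc : Finset.Icc 1 (n * q) = Finset.Ico (0 + 1) (n * q + 1) := by
      ext; simp only [Finset.mem_Icc, Finset.mem_Ico]; omega
    rw [hIcc]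
    have hneg : ∑ k ∈ Finset.Ico (0 + 1) (n * q + 1), (-1 : ℤ) ^ (k - 1) *
        ∑ v ∈ (Fintype.piFinset fun _ : Fin n => Finset.range (q + 1)).filter
            (fun v => ∑ j : Fin n, v j = k),
          (∏ j : Fin n, (q.choose (v j) : ℤ)) * (q : ℤ) ^ (∏ j : Fin n, (q - v j))
        = - ∑ k ∈ Finset.Ico (0 + 1) (n * q + 1),
        ∑ v ∈ (Fintype.piFinset fun _ : Fin n => Finset.range (q + 1)).filter
            (fun v => ∑ j : Fin n, v j = k),
          (∏ j : Fin n, (q.choose (v j) : ℤ)) * ((-1 : ℤ) ^ (∑ j, v j) *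
            (q : ℤ) ^ (∏ j : Fin n, (q - v j))) := by
      rw [← Finset.sum_neg_distrib]
      refine Finset.sum_congr rfl fun k hk => ?_
      rw [Finset.mul_sum, ← Finset.sum_neg_distrib]
      refine Finset.sum_congr rfl fun v hv => ?_
      rw [(Finset.mem_filter.1 hv).2]
      obtain ⟨m, rfl⟩ : ∃ m, k = m + 1 := ⟨k - 1, by have := (Finset.mem_Ico.1 hk).1; omega⟩
      rw [Nat.add_sub_cancel, pow_succ]
      ring
    rw [hneg]
    linarith
  · intro v hv
    simp only [Fintype.mem_piFinset, Finset.mem_range] at hv ⊢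
    have : ∑ j, v j ≤ ∑ _j : Fin n, q := Finset.sum_le_sum fun j _ => by have := hv j; omega
    simp at this
    omega
end

section
/- Fix a prime power q, the finite field F = F_q with q elements, n ≥ 1, and an index i ∈ {1,…,n}. Let b₁,…,b_r ∈ F be pairwise distinct, and let a_{11},…,a_{1k₁}; a_{21},…,a_{2k₂}; …; a_{r1},…,a_{rk_r} be k₁+k₂+⋯+k_r pairwise distinct elements of F (each k_s ≥ 1, k₁+⋯+k_r ≤ q). Then the number of functions f : Fⁿ → F that are ⟨i:a_{sj}:b_s⟩ canalyzing for every s ∈ {1,…,r} and every j ∈ {1,…,k_s} equals q^((q − k₁ − k₂ − ⋯ − k_r)·q^(n−1)). -/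
theorem stmt_13 {q n : ℕ} (hq : IsPrimePow q) (hn : 1 ≤ n)
    (F : Type*) [Field F] [Fintype F] (hcard : Fintype.card F = q)
    (i : Fin n) (r : ℕ) (k : Fin r → ℕ) (hk : ∀ s : Fin r, 1 ≤ k s)
    (hsum : ∑ s : Fin r, k s ≤ q)
    (b : Fin r → F) (hb : Function.Injective b)
    (a : (s : Fin r) → Fin (k s) → F)
    (ha : Function.Injective fun p : (s : Fin r) × Fin (k s) => a p.1 p.2) :
    Set.ncard {f : (Fin n → F) → F |
        ∀ (s : Fin r) (j : Fin (k s)), IsCanalyzing f i (a s j) (b s)} =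
      q ^ ((q - ∑ s : Fin r, k s) * q ^ (n - 1)) := by
  classical
  set A : ((s : Fin r) × Fin (k s)) → F := fun p => a p.1 p.2 with hA
  set g : F → F := Function.extend A (fun p => b p.1) 0 with hg
  have hgA : ∀ p, g (A p) = b p.1 := fun p => ha.extend_apply _ _ p
  set S : Finset F := Finset.univ.image A with hS
  have hScard : S.card = ∑ s : Fin r, k s := by
    rw [hS, Finset.card_image_of_injective _ ha]
    simp
  have hset : {f : (Fin n → F) → F |
        ∀ (s : Fin r) (j : Fin (k s)), IsCanalyzing f i (a s j) (b s)} =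
      ((Fintype.piFinset (fun x : Fin n → F => if x i ∈ S then {g (x i)} else Finset.univ) :
        Finset ((Fin n → F) → F)) : Set ((Fin n → F) → F)) := by
    ext f
    simp only [Set.mem_setOf_eq, Finset.mem_coe, Fintype.mem_piFinset]
    constructor
    · intro h x
      split_ifs with hx
      · obtain ⟨p, -, hp⟩ := Finset.mem_image.1 hx
        rw [Finset.mem_singleton, ← hp, hgA]
        have := h p.1 p.2 x
        have h2 : a p.1 p.2 = x i := hp
        rwa [h2, Function.update_eq_self] at this
      · exact Finset.mem_univ _
    · intro h s j x
      have := h (Function.update x i (a s j))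
      have hm : a s j ∈ S := Finset.mem_image.2 ⟨⟨s, j⟩, Finset.mem_univ _, rfl⟩
      rw [Function.update_self, if_pos hm, Finset.mem_singleton] at this
      rw [this]
      exact hgA ⟨s, j⟩
  have hfil : (Finset.univ.filter (fun x : Fin n → F => ¬ x i ∈ S)) =
      Fintype.piFinset (fun j : Fin n => if j = i then Sᶜ else Finset.univ) := by
    ext x
    simp only [Finset.mem_filter, Finset.mem_univ, true_and, Fintype.mem_piFinset]
    constructor
    · intro h j
      split_ifs with hj
      · subst hj
        exact Finset.mem_compl.2 h
      · exact Finset.mem_univ _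
    · intro h
      have := h i
      rw [if_pos rfl] at this
      exact Finset.mem_compl.1 this
  have hfc : (Finset.univ.filter (fun x : Fin n → F => ¬ x i ∈ S)).card =
      (q - ∑ s : Fin r, k s) * q ^ (n - 1) := by
    rw [hfil, Fintype.card_piFinset, ← Finset.mul_prod_erase _ _ (Finset.mem_univ i), if_pos rfl,
      Finset.card_compl, hScard, hcard]
    congr 1
    rw [Finset.prod_congr rfl (g := fun _ => q)]
    · simp
    · intro j hj
      rw [if_neg (Finset.ne_of_mem_erase hj), Finset.card_univ, hcard]
  rw [hset, Set.ncard_coe_finset, Fintype.card_piFinset, ← hfc]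
  have : ∀ x : Fin n → F, (if x i ∈ S then ({g (x i)} : Finset F) else Finset.univ).card =
      if x i ∈ S then 1 else q := by
    intro x
    split_ifs <;> simp [hcard]
  rw [Finset.prod_congr rfl (fun x _ => this x), Finset.prod_ite]
  simp
end

section
/- Fix a prime power q, the finite field F = F_q with q elements, n ≥ 1, and an index i ∈ {1,…,n}. The number of functions f : Fⁿ → F that are ⟨i:a:b⟩ canalyzing for some a ∈ F and some b ∈ F equals q! · Σ_{k=1}^{q} [ (−1)^(k−1) · q^((q−k)·q^(n−1)) / (q−k)! ] · Σ_{(k₁,…,k_q): k₁+⋯+k_q = k, 0 ≤ k_j ≤ q} 1/(k₁!·k₂!⋯k_q!); i.e. |C^i_{*,*}| is given by this formula. -/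
theorem sum_inv_fact (q k : ℕ) (hk : k ≤ q) :
    ∑ v ∈ (Fintype.piFinset fun _ : Fin q => Finset.range (q + 1)) |>.filter
              (fun v => ∑ j : Fin q, v j = k),
            (∏ j : Fin q, ((v j).factorial : ℚ))⁻¹ = (q : ℚ) ^ k / (k.factorial : ℚ) := by
  have hS : ((Fintype.piFinset fun _ : Fin q => Finset.range (q + 1)).filter
      (fun v => ∑ j : Fin q, v j = k)) = Finset.piAntidiag Finset.univ k := by
    ext v
    simp only [Finset.mem_filter, Fintype.mem_piFinset, Finset.mem_range, Finset.mem_piAntidiag,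
      Finset.mem_univ, implies_true, and_true, and_iff_right_iff_imp]
    intro h j
    have := Finset.single_le_sum (f := v) (fun _ _ => Nat.zero_le _) (Finset.mem_univ j)
    omega
  rw [hS]
  have h := Finset.sum_pow_eq_sum_piAntidiag (Finset.univ : Finset (Fin q)) (fun _ => (1 : ℚ)) k
  simp only [Finset.sum_const, Finset.card_univ, Fintype.card_fin, nsmul_eq_mul, mul_one, one_pow,
    Finset.prod_const_one] at h
  rw [h, Finset.sum_div]
  refine Finset.sum_congr rfl fun v hv => ?_
  have h2 := Nat.multinomial_spec (Finset.univ : Finset (Fin q)) v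
  rw [(Finset.mem_piAntidiag.1 hv).1] at h2
  have h3 : (∏ j : Fin q, ((v j).factorial : ℚ)) * (Nat.multinomial Finset.univ v : ℚ)
      = (k.factorial : ℚ) := by exact_mod_cast h2
  have hp : (∏ j : Fin q, ((v j).factorial : ℚ)) ≠ 0 :=
    Finset.prod_ne_zero_iff.2 fun j _ => by exact_mod_cast Nat.factorial_ne_zero _
  have hk0 : (k.factorial : ℚ) ≠ 0 := by exact_mod_cast Nat.factorial_ne_zero _
  rw [eq_div_iff hk0, ← h3]
  field_simp

theorem count_aux_s14 (F : Type*) [Fintype F] [Nonempty F] (m : ℕ) (i : Fin (m + 1)) :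
    (Set.ncard {f : (Fin (m + 1) → F) → F | ∃ a b : F, IsCanalyzing f i a b} : ℚ) =
      ((Fintype.card F : ℚ) ^ (Fintype.card F ^ m)) ^ Fintype.card F -
      ((Fintype.card F : ℚ) ^ (Fintype.card F ^ m) - Fintype.card F) ^ Fintype.card F := by
  classical
  let e : ((Fin (m + 1) → F) → F) ≃ (F → (Fin m → F) → F) :=
    (Equiv.arrowCongr (Fin.insertNthEquiv (fun _ => F) i).symm (Equiv.refl F)).trans
      (Equiv.curry _ _ _)
  have he : ∀ f a y, e f a y = f (i.insertNth a y) := fun f a y => rfl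
  let C : Finset ((Fin m → F) → F) := Finset.univ.image (fun b : F => fun _ => b)
  have hC : C.card = Fintype.card F := by
    rw [Finset.card_image_of_injective, Finset.card_univ]
    intro a b h
    exact congrFun h (fun _ => a)
  let P : Finset (F → (Fin m → F) → F) := Fintype.piFinset fun _ => Cᶜ
  have hset : {f : (Fin (m + 1) → F) → F | ∃ a b : F, IsCanalyzing f i a b}
      = e ⁻¹' ((Pᶜ : Finset _) : Set _) := by
    ext f
    simp only [Set.mem_ofPred_eq, Set.mem_preimage, Finset.coe_compl, Set.mem_compl_iff,
      Finset.mem_coe, P, Fintype.mem_piFinset, Finset.mem_compl, not_forall, not_not, C,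
      Finset.mem_image, Finset.mem_univ, true_and]
    refine exists_congr fun a => exists_congr fun b => ?_
    constructor
    · intro h
      funext y
      rw [he, ← h (i.insertNth a y)]
      simp
    · intro h x
      have := congrFun h (i.removeNth x)
      rw [he, Fin.insertNth_removeNth] at this
      exact this.symm
  have hle : Fintype.card F ≤ Fintype.card F ^ (Fintype.card F ^ m) := by
    rw [← hC]; refine (Finset.card_le_univ C).trans ?_
    simp [hC]
  have hP : P.card = (Fintype.card F ^ (Fintype.card F ^ m) - Fintype.card F) ^ Fintype.card F := by
    simp [P, Fintype.card_piFinset, Finset.card_compl, hC]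
  have hPle := Finset.card_le_univ P
  rw [hset, Set.ncard_preimage_of_injective_subset_range e.injective (by simp),
    Set.ncard_coe_finset, Finset.card_compl, Nat.cast_sub hPle, hP]
  push_cast [Nat.cast_sub hle]
  simp

theorem stmt_14 {q n : ℕ} (hq : IsPrimePow q) (hn : 1 ≤ n)
    (F : Type*) [Field F] [Fintype F] (hcard : Fintype.card F = q)
    (i : Fin n) :
    (Set.ncard {f : (Fin n → F) → F | ∃ a b : F, IsCanalyzing f i a b} : ℚ) =
      (q.factorial : ℚ) * ∑ k ∈ Finset.Icc 1 q,
        ((-1 : ℚ) ^ (k - 1) * (q : ℚ) ^ ((q - k) * q ^ (n - 1)) / ((q - k).factorial : ℚ)) *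
          ∑ v ∈ (Fintype.piFinset fun _ : Fin q => Finset.range (q + 1)) |>.filter
              (fun v => ∑ j : Fin q, v j = k),
            (∏ j : Fin q, ((v j).factorial : ℚ))⁻¹ := by
  obtain ⟨m, rfl⟩ : ∃ m, n = m + 1 := ⟨n - 1, by omega⟩
  rw [count_aux_s14 F m i, hcard, Nat.add_sub_cancel]
  have h1 : ∀ k ∈ Finset.Icc 1 q,
        ((-1 : ℚ) ^ (k - 1) * (q : ℚ) ^ ((q - k) * q ^ m) / ((q - k).factorial : ℚ)) *
          ∑ v ∈ (Fintype.piFinset fun _ : Fin q => Finset.range (q + 1)) |>.filter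
              (fun v => ∑ j : Fin q, v j = k),
            (∏ j : Fin q, ((v j).factorial : ℚ))⁻¹ =
        -((-(q : ℚ)) ^ k * ((q : ℚ) ^ (q ^ m)) ^ (q - k) * (q.choose k : ℚ)) / (q.factorial : ℚ) := by
    intro k hk
    obtain ⟨hk1, hk2⟩ := Finset.mem_Icc.1 hk
    rw [sum_inv_fact q k hk2, Nat.cast_choose ℚ hk2, ← pow_mul, mul_comm (q ^ m), neg_pow (q : ℚ)]
    obtain ⟨l, rfl⟩ : ∃ l, k = l + 1 := ⟨k - 1, by omega⟩
    have a1 : ((l + 1).factorial : ℚ) ≠ 0 := by exact_mod_cast Nat.factorial_ne_zero _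
    have a2 : ((q - (l + 1)).factorial : ℚ) ≠ 0 := by exact_mod_cast Nat.factorial_ne_zero _
    have a3 : (q.factorial : ℚ) ≠ 0 := by exact_mod_cast Nat.factorial_ne_zero _
    rw [Nat.add_sub_cancel, pow_succ (-1 : ℚ) l]
    field_simp
  rw [Finset.sum_congr rfl h1, ← Finset.sum_div, Finset.sum_neg_distrib,
    mul_div_cancel₀ _ (by exact_mod_cast Nat.factorial_ne_zero _)]
  have h2 := add_pow (-(q : ℚ)) ((q : ℚ) ^ (q ^ m)) q
  rw [Finset.sum_range_succ', Finset.sum_bij (t := Finset.Icc 1 q)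
    (g := fun k => (-(q : ℚ)) ^ k * ((q : ℚ) ^ (q ^ m)) ^ (q - k) * (q.choose k : ℚ))
    (i := fun k _ => k + 1)] at h2
  · rw [sub_eq_neg_add ((q : ℚ) ^ (q ^ m)) (q : ℚ), h2]
    simp
  · intro k hk
    simp at hk ⊢
    omega
  · intro a _ b _ h
    omega
  · intro b hb
    simp at hb
    exact ⟨b - 1, by simp; omega, by omega⟩
  · intro k hk
    rfl
end

section
/- Fix a prime power q, the finite field F = F_q with q elements, and n ≥ 1. The number of canalyzing functions f : Fⁿ → F (i.e. functions that are ⟨i:a:b⟩ canalyzing for some i ∈ {1,…,n}, a ∈ F, b ∈ F) equals Σ_{k=1}^{q} (−1)^(k−1) U_k + Σ_{k=1}^{nq} (−1)^(k−1) V_k, where U_k = (n·q!/(q−k)!) · q^((q−k)·q^(n−1)) · Σ_{(t₁,…,t_q): t₁+⋯+t_q = k, 0 ≤ t_j ≤ q} 1/(t₁!·t₂!⋯t_q!), and V_k = q · Σ_{(k₁,…,k_n): k₁+⋯+k_n = k, 0 ≤ k_j ≤ k−1, 0 ≤ k_j ≤ q} (∏_{j=1}^{n} C(q,k_j)) ·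 q^(∏_{j=1}^{n} (q − k_j)). -/
open Finset in
lemma canal_iff {F : Type*} {m : ℕ} (f : (Fin (m+1) → F) → F) (i : Fin (m+1)) (a b : F) :
    IsCanalyzing f i a b ↔ (fun y : Fin m → F => f (i.insertNth a y)) = fun _ => b := by
  constructor
  · intro h
    funext y
    have := h (i.insertNth a y)
    simpa using this
  · intro h x
    have := congrFun h (i.removeNth x)
    simpa [Fin.insertNth_removeNth] using this

open Finset in
lemma slice_count {F : Type*} [Fintype F] [DecidableEq F] {m : ℕ} (i : Fin (m+1))
    (Bad : Finset ((Fin m → F) → F)) :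
    (univ.filter (fun f : (Fin (m+1) → F) → F =>
      ∀ a, (fun y : Fin m → F => f (i.insertNth a y)) ∉ Bad)).card =
      ((Fintype.card F) ^ ((Fintype.card F) ^ m) - Bad.card) ^ (Fintype.card F) := by
  have h1 : (Fintype.piFinset (fun _ : F => Badᶜ)).card =
      ((Fintype.card F) ^ ((Fintype.card F) ^ m) - Bad.card) ^ (Fintype.card F) := by
    rw [Fintype.card_piFinset]
    simp [Finset.card_compl]
  rw [← h1]
  refine Finset.card_bij' (fun f _ => fun a y => f (i.insertNth a y))
    (fun g _ => fun x => g (x i) (i.removeNth x)) ?_ ?_ ?_ ?_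
  · intro f hf
    simpa using hf
  · intro g hg
    simpa using hg
  · intro f hf
    funext x
    simp
  · intro g hg
    funext a y
    simp

open Finset in
lemma union_count {F : Type*} [Fintype F] [DecidableEq F] {n : ℕ} (b : F)
    (A : Fin n → Finset F) :
    (univ.filter (fun f : (Fin n → F) → F => ∀ x, (∃ i, x i ∈ A i) → f x = b)).card =
      (Fintype.card F) ^ (∏ i, (Fintype.card F - (A i).card)) := by
  have h1 : (univ.filter (fun f : (Fin n → F) → F => ∀ x, (∃ i, x i ∈ A i) → f x = b)) =
      Fintype.piFinset (fun x : Fin n → F => if ∃ i, x i ∈ A i then {b} else univ) := by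
    ext f
    simp only [mem_filter, mem_univ, true_and, Fintype.mem_piFinset]
    refine forall_congr' fun x => ?_
    split_ifs with h <;> simp [h]
  rw [h1, Fintype.card_piFinset]
  have h2 : ∀ x : Fin n → F, (if ∃ i, x i ∈ A i then ({b} : Finset F) else univ).card =
      if ¬ ∃ i, x i ∈ A i then Fintype.card F else 1 := by
    intro x
    split_ifs <;> simp
  rw [Finset.prod_congr rfl (fun x _ => h2 x), ← Finset.prod_filter, Finset.prod_const]
  congr 1
  have h3 : (univ.filter (fun x : Fin n → F => ¬ ∃ i, x i ∈ A i)) =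
      Fintype.piFinset (fun i => (A i)ᶜ) := by
    ext x
    simp
  rw [h3, Fintype.card_piFinset]
  simp [Finset.card_compl]

open Finset in
lemma group_sum {F : Type*} [Fintype F] [DecidableEq F] {n : ℕ} (G : (Fin n → ℕ) → ℚ) :
    ∑ A : Fin n → Finset F, G (fun i => (A i).card) =
      ∑ v ∈ Fintype.piFinset (fun _ : Fin n => Finset.range (Fintype.card F + 1)),
        (∏ j, ((Fintype.card F).choose (v j) : ℚ)) * G v := by
  rw [← Finset.sum_fiberwise_of_maps_to (s := univ)
    (t := Fintype.piFinset (fun _ : Fin n => Finset.range (Fintype.card F + 1)))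
    (g := fun A : Fin n → Finset F => fun i => (A i).card)]
  · refine Finset.sum_congr rfl fun v _ => ?_
    have h : (univ.filter (fun A : Fin n → Finset F => (fun i => (A i).card) = v)) =
        Fintype.piFinset (fun i => powersetCard (v i) univ) := by
      ext A
      simp [funext_iff, mem_powersetCard]
    rw [Finset.sum_congr rfl (g := fun _ => G v)]
    · rw [Finset.sum_const, h, Fintype.card_piFinset]
      simp [card_powersetCard]
    · intro A hA
      rw [(mem_filter.1 hA).2]
  · intro A _
    simp only [Fintype.mem_piFinset, mem_range]
    intro i
    exact Nat.lt_succ_of_le (card_le_univ _)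

open Finset Classical in
/-- Inclusion-exclusion for a fixed output `b`. -/
lemma incl_excl {F : Type*} [Fintype F] {n : ℕ} (b : F) :
    ((univ.filter (fun f : (Fin n → F) → F => ∀ i a, ¬ IsCanalyzing f i a b)).card : ℚ) =
      ∑ v ∈ Fintype.piFinset (fun _ : Fin n => Finset.range (Fintype.card F + 1)),
        (∏ j, ((Fintype.card F).choose (v j) : ℚ)) *
          ((-1) ^ (∑ j, v j) * (Fintype.card F : ℚ) ^ (∏ j, (Fintype.card F - v j))) := by
  rw [← group_sum (F := F) (fun v => (-1) ^ (∑ j, v j) *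
    (Fintype.card F : ℚ) ^ (∏ j, (Fintype.card F - v j)))]
  have h1 : ∀ f : (Fin n → F) → F,
      (if ∀ i a, ¬ IsCanalyzing f i a b then (1 : ℚ) else 0) =
      ∑ A : Fin n → Finset F, if (∀ x, (∃ i, x i ∈ A i) → f x = b) then
        (-1 : ℚ) ^ (∑ j, (A j).card) else 0 := by
    intro f
    have e1 : ∀ i, (∑ s ∈ (univ.filter (fun a => IsCanalyzing f i a b)).powerset,
        (-1 : ℚ) ^ s.card) = if ∀ a, ¬ IsCanalyzing f i a b then 1 else 0 := by
      intro i
      have := Finset.sum_powerset_neg_one_pow_card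
        (x := univ.filter (fun a => IsCanalyzing f i a b))
      have h := congrArg (Int.cast : ℤ → ℚ) this
      push_cast at h
      rw [h]
      simp [Finset.filter_eq_empty_iff]
    have e2 := Finset.prod_congr rfl (fun i (_ : i ∈ (univ : Finset (Fin n))) => e1 i)
    rw [Finset.prod_univ_sum] at e2
    have e3 : (∏ i : Fin n, if ∀ a, ¬ IsCanalyzing f i a b then (1 : ℚ) else 0) =
        if ∀ i a, ¬ IsCanalyzing f i a b then (1 : ℚ) else 0 := by
      rw [Finset.prod_ite_zero]
      simp
    rw [← e3, ← e2, ← Finset.sum_filter]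
    refine Finset.sum_congr ?_ ?_
    · ext A
      simp only [Fintype.mem_piFinset, mem_powerset, mem_filter, mem_univ, true_and,
        subset_iff]
      constructor
      · rintro h x ⟨i, hi⟩
        have := h i hi x
        rwa [Function.update_eq_self] at this
      · intro h i a ha x
        exact h _ ⟨i, by simpa using ha⟩
    · intro A _
      rw [Finset.prod_pow_eq_pow_sum]
  rw [Finset.card_filter]
  push_cast
  rw [Finset.sum_congr rfl (fun f _ => h1 f), Finset.sum_comm]
  refine Finset.sum_congr rfl fun A _ => ?_
  rw [← Finset.sum_filter, Finset.sum_const, nsmul_eq_mul, mul_comm]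
  congr 1
  have := union_count b A
  rw [← Nat.cast_pow, ← this]

open Finset Classical in
lemma no_canal_ib {F : Type*} [Fintype F] {m : ℕ} (i : Fin (m+1)) (b : F) :
    ((univ.filter (fun f : (Fin (m+1) → F) → F => ∀ a, ¬ IsCanalyzing f i a b)).card : ℚ) =
      ((Fintype.card F : ℚ) ^ ((Fintype.card F) ^ m) - 1) ^ (Fintype.card F) := by
  have h := slice_count i ({fun _ => b} : Finset ((Fin m → F) → F))
  simp only [mem_singleton, ← canal_iff, card_singleton] at h
  have hpos : 0 < Fintype.card F := Fintype.card_pos_iff.2 ⟨b⟩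
  rw [h, Nat.cast_pow, Nat.cast_sub (Nat.one_le_pow _ _ hpos)]
  push_cast
  rfl

open Finset Classical in
lemma no_canal_i {F : Type*} [Fintype F] [Nonempty F] {m : ℕ} (i : Fin (m+1)) :
    ((univ.filter (fun f : (Fin (m+1) → F) → F => ∀ a b, ¬ IsCanalyzing f i a b)).card : ℚ) =
      ((Fintype.card F : ℚ) ^ ((Fintype.card F) ^ m) - Fintype.card F) ^ (Fintype.card F) := by
  have h := slice_count i
    ((univ : Finset F).image (fun b => (fun _ => b : (Fin m → F) → F)))
  have hpos : 0 < Fintype.card F := Fintype.card_pos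
  have hc : ((univ : Finset F).image (fun b => (fun _ => b : (Fin m → F) → F))).card =
      Fintype.card F := by
    rw [Finset.card_image_of_injective, card_univ]
    intro b c hbc
    exact congrFun hbc (fun _ => Classical.arbitrary F)
  rw [hc] at h
  have hf : (univ.filter (fun f : (Fin (m+1) → F) → F => ∀ a b, ¬ IsCanalyzing f i a b)) =
     (univ.filter (fun f : (Fin (m+1) → F) → F =>
      ∀ a, (fun y : Fin m → F => f (i.insertNth a y)) ∉
        ((univ : Finset F).image (fun b => (fun _ => b : (Fin m → F) → F))))) := by
    ext f
    simp [canal_iff, eq_comm]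
  rw [hf, h, Nat.cast_pow, Nat.cast_sub]
  · push_cast
    rfl
  · exact Nat.le_self_pow (pow_pos hpos _).ne' _

open Finset Classical in
/-- Pointwise identity. -/
lemma pointwise {F : Type*} [Fintype F] {n : ℕ} (f : (Fin n → F) → F) :
    (if ∃ i a b, IsCanalyzing f i a b then (1 : ℚ) else 0) =
      ∑ b : F, (if ∃ i a, IsCanalyzing f i a b then (1 : ℚ) else 0)
      - ∑ b : F, ∑ i : Fin n, (if ∃ a, IsCanalyzing f i a b then (1 : ℚ) else 0)
      + ∑ i : Fin n, (if ∃ a b, IsCanalyzing f i a b then (1 : ℚ) else 0) := by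
  have key : ∀ i j a a' b b', IsCanalyzing f i a b → IsCanalyzing f j a' b' → b ≠ b' → i = j := by
    intro i j a a' b b' h h' hb
    by_contra hij
    apply hb
    have e1 := h (Function.update (fun _ => a) j a')
    have e2 := h' (Function.update (fun _ => a) i a)
    rw [Function.update_comm (Ne.symm hij)] at e1
    rw [← e1, ← e2]
  by_cases h0 : ∃ i a b, IsCanalyzing f i a b
  · obtain ⟨i₀, a₀, b₀, h⟩ := h0
    by_cases h1 : ∀ i a b, IsCanalyzing f i a b → i = i₀
    · have e1 : ∀ b, (∑ i : Fin n, (if ∃ a, IsCanalyzing f i a b then (1 : ℚ) else 0)) =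
          if ∃ i a, IsCanalyzing f i a b then (1 : ℚ) else 0 := by
        intro b
        rw [Finset.sum_eq_single i₀]
        · congr 1
          apply propext
          constructor
          · rintro ⟨a, ha⟩
            exact ⟨i₀, a, ha⟩
          · rintro ⟨i, a, ha⟩
            exact ⟨a, h1 i a b ha ▸ ha⟩
        · intro i _ hi
          rw [if_neg]
          rintro ⟨a, ha⟩
          exact hi (h1 i a b ha)
        · simp
      rw [Finset.sum_congr rfl (fun b _ => e1 b), sub_self, zero_add,
        Finset.sum_eq_single i₀, if_pos ⟨i₀, a₀, b₀, h⟩, if_pos ⟨a₀, b₀, h⟩]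
      · intro i _ hi
        rw [if_neg]
        rintro ⟨a, b, ha⟩
        exact hi (h1 i a b ha)
      · simp
    · push Not at h1
      obtain ⟨i₁, a₁, b₁, h', hne⟩ := h1
      have hb : b₁ = b₀ := by
        by_contra hb
        exact hne (key _ _ _ _ _ _ h' h hb)
      subst hb
      have h2 : ∀ i a b, IsCanalyzing f i a b → b = b₁ := by
        intro i a b hh
        by_contra hb
        exact hne ((key _ _ _ _ _ _ hh h' hb).symm.trans (key _ _ _ _ _ _ hh h hb))
      have e1 : ∀ i, (∑ b : F, (if ∃ a, IsCanalyzing f i a b then (1 : ℚ) else 0)) =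
          if ∃ a b, IsCanalyzing f i a b then (1 : ℚ) else 0 := by
        intro i
        rw [Finset.sum_eq_single b₁]
        · congr 1
          apply propext
          constructor
          · rintro ⟨a, ha⟩
            exact ⟨a, b₁, ha⟩
          · rintro ⟨a, b, ha⟩
            exact ⟨a, h2 i a b ha ▸ ha⟩
        · intro b _ hi
          rw [if_neg]
          rintro ⟨a, ha⟩
          exact hi (h2 i a b ha)
        · simp
      rw [Finset.sum_comm, Finset.sum_congr rfl (fun i _ => e1 i), sub_add_cancel,
        Finset.sum_eq_single b₁, if_pos ⟨i₀, a₀, b₁, h⟩, if_pos ⟨i₀, a₀, h⟩]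
      · intro b _ hi
        rw [if_neg]
        rintro ⟨i, a, ha⟩
        exact hi (h2 i a b ha)
      · simp
  · have h1 : ∀ i a b, ¬ IsCanalyzing f i a b := by
      intro i a b h
      exact h0 ⟨i, a, b, h⟩
    simp [h1]

open Finset in
lemma count_compl {α : Type*} [Fintype α] (P R : α → Prop) [DecidablePred P] [DecidablePred R]
    (hPR : ∀ f, R f ↔ ¬ P f) :
    (∑ f : α, if P f then (1 : ℚ) else 0) =
      (Fintype.card α : ℚ) - ((univ.filter (fun f => R f)).card : ℚ) := by
  rw [Finset.card_filter]
  push_cast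
  have : (Fintype.card α : ℚ) = ∑ f : α, 1 := by simp
  rw [this, ← Finset.sum_sub_distrib]
  refine Finset.sum_congr rfl fun f _ => ?_
  by_cases h : P f <;> simp [h, hPR]

open Finset in
/-- Sum over `v` with at least two nonzero entries. -/
lemma split_sum {m q : ℕ} (W : (Fin (m+1) → ℕ) → ℚ) :
    ∑ v ∈ Fintype.piFinset (fun _ : Fin (m+1) => Finset.range (q + 1)), W v =
      ∑ k ∈ Icc 1 ((m+1)*q), ∑ v ∈ (Fintype.piFinset
        (fun _ : Fin (m+1) => Finset.range (q + 1))).filter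
          (fun v => (∑ j, v j) = k ∧ ∀ j, v j ≤ k - 1), W v
      + W 0 + ∑ i : Fin (m+1), ∑ k ∈ Icc 1 q, W (Pi.single i k) := by
  classical
  set S := Fintype.piFinset (fun _ : Fin (m+1) => Finset.range (q + 1)) with hS
  have hmem : ∀ v, v ∈ S ↔ ∀ i, v i ≤ q := by
    intro v
    simp [hS]
  have h1 : ∑ k ∈ Icc 1 ((m+1)*q), ∑ v ∈ S.filter
          (fun v => (∑ j, v j) = k ∧ ∀ j, v j ≤ k - 1), W v =
      ∑ v ∈ S.filter (fun v => (∑ j, v j) ≠ 0 ∧ ∀ j, v j ≠ ∑ j, v j), W v := by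
    rw [← Finset.sum_fiberwise_of_maps_to
      (s := S.filter (fun v => (∑ j, v j) ≠ 0 ∧ ∀ j, v j ≠ ∑ j, v j))
      (t := Icc 1 ((m+1)*q)) (g := fun v => ∑ j, v j)]
    · refine Finset.sum_congr rfl fun k hk => ?_
      refine Finset.sum_congr ?_ fun _ _ => rfl
      have hk1 := (mem_Icc.1 hk).1
      ext v
      have hle : ∀ j, v j ≤ ∑ j, v j := fun j =>
        Finset.single_le_sum (f := v) (fun _ _ => Nat.zero_le _) (mem_univ j)
      simp only [mem_filter]
      constructor
      · rintro ⟨hv, rfl, h⟩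
        refine ⟨⟨hv, by omega, fun j => ?_⟩, rfl⟩
        have := h j
        omega
      · rintro ⟨⟨hv, h0, h⟩, rfl⟩
        refine ⟨hv, rfl, fun j => ?_⟩
        have := h j
        have := hle j
        omega
    · intro v hv
      obtain ⟨hv, h0, -⟩ := mem_filter.1 hv
      rw [hmem] at hv
      rw [mem_Icc]
      refine ⟨by omega, ?_⟩
      calc ∑ j, v j ≤ ∑ j : Fin (m+1), q := Finset.sum_le_sum fun j _ => hv j
        _ = _ := by simp
  rw [h1, ← Finset.sum_filter_add_sum_filter_not S
    (fun v => (∑ j, v j) ≠ 0 ∧ ∀ j, v j ≠ ∑ j, v j), add_assoc]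
  congr 1
  have h2 : S.filter (fun v => ¬ ((∑ j, v j) ≠ 0 ∧ ∀ j, v j ≠ ∑ j, v j)) =
      insert 0 ((univ ×ˢ Icc 1 q).image
        (fun p : Fin (m+1) × ℕ => (Pi.single p.1 p.2 : Fin (m+1) → ℕ))) := by
    ext v
    simp only [mem_filter, mem_insert, mem_image, mem_product, mem_univ, true_and, hmem,
      Prod.exists, mem_Icc]
    constructor
    · rintro ⟨hv, h⟩
      by_cases h0 : ∑ j, v j = 0
      · left
        funext j
        exact (Finset.sum_eq_zero_iff.1 h0) j (mem_univ j)
      · right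
        have : ∃ j, v j = ∑ j, v j := by
          by_contra hc
          push Not at hc
          exact h ⟨h0, hc⟩
        obtain ⟨i, hi⟩ := this
        refine ⟨i, v i, ⟨by omega, hv i⟩, ?_⟩
        funext j
        by_cases hj : j = i
        · subst hj
          simp
        · rw [Pi.single_eq_of_ne hj]
          have e := Finset.add_sum_erase univ v (mem_univ i)
          have e0 : ∑ x ∈ univ.erase i, v x = 0 := by omega
          exact ((Finset.sum_eq_zero_iff.1 e0) j (by simp [hj])).symm
    · rintro (rfl | ⟨i, k, ⟨hk1, hk2⟩, rfl⟩)
      · simp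
      · refine ⟨fun j => ?_, ?_⟩
        · by_cases hj : j = i
          · subst hj
            simpa using hk2
          · simp [Pi.single_eq_of_ne hj]
        · rintro ⟨-, h⟩
          apply h i
          simp
  rw [h2, Finset.sum_insert, Finset.sum_image, Finset.sum_product]
  · rintro ⟨i, k⟩ hik ⟨j, l⟩ hjl h
    simp only [coe_product, coe_univ, coe_Icc, Set.mem_prod, Set.mem_univ, true_and,
      Set.mem_Icc] at hik hjl
    simp only at h
    have e := congrFun h i
    by_cases hij : i = j
    · subst hij
      simpa using e
    · rw [Pi.single_eq_same, Pi.single_eq_of_ne hij] at e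
      omega
  · simp only [mem_image, mem_product, mem_univ, true_and, mem_Icc, Prod.exists, not_exists,
      not_and]
    rintro i k ⟨hk, -⟩ h
    have e := congrFun h i
    rw [Pi.single_eq_same] at e
    simp at e
    omega

open Finset in
lemma single_W {m q : ℕ} (i : Fin (m+1)) (k : ℕ) :
    (∏ j, (q.choose ((Pi.single i k : Fin (m+1) → ℕ) j) : ℚ)) *
      ((-1) ^ (∑ j, (Pi.single i k : Fin (m+1) → ℕ) j) *
        (q : ℚ) ^ (∏ j, (q - (Pi.single i k : Fin (m+1) → ℕ) j))) =
    (q.choose k : ℚ) * ((-1) ^ k * (q : ℚ) ^ ((q - k) * q ^ m)) := by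
  have h1 : (∏ j, (q.choose ((Pi.single i k : Fin (m+1) → ℕ) j) : ℚ)) = q.choose k := by
    rw [Finset.prod_eq_single i]
    · simp
    · intro j _ hj
      simp [Pi.single_eq_of_ne hj]
    · simp
  have h2 : (∏ j, (q - (Pi.single i k : Fin (m+1) → ℕ) j)) = (q - k) * q ^ m := by
    rw [← Finset.mul_prod_erase univ _ (mem_univ i), Pi.single_eq_same]
    congr 1
    rw [Finset.prod_congr rfl (g := fun _ => q)]
    · simp [card_erase_of_mem]
    · intro j hj
      simp [Pi.single_eq_of_ne (ne_of_mem_erase hj)]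
  rw [h1, h2]
  simp

open Finset in
lemma binom_Icc (q : ℕ) (Q c : ℚ) :
    (Q - c) ^ q - Q ^ q = ∑ k ∈ Icc 1 q, (q.choose k : ℚ) * ((-1) ^ k * c ^ k * Q ^ (q - k)) := by
  have h : (Q - c) ^ q = ∑ k ∈ range (q+1), (q.choose k : ℚ) * ((-1) ^ k * c ^ k * Q ^ (q - k)) := by
    rw [sub_eq_neg_add, add_pow]
    refine Finset.sum_congr rfl fun k _ => ?_
    rw [neg_pow c]
    ring
  have h2 : range (q+1) = insert 0 (Icc 1 q) := by
    ext k
    simp only [mem_range, mem_insert, mem_Icc]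
    omega
  rw [h, h2, Finset.sum_insert (by simp)]
  simp

open Finset in
/-- The multinomial identity. -/
lemma multinom {q k : ℕ} (hk : k ≤ q) :
    ∑ t ∈ (Fintype.piFinset fun _ : Fin q => Finset.range (q + 1)).filter
        (fun t => ∑ j : Fin q, t j = k), (∏ j : Fin q, ((t j).factorial : ℚ))⁻¹ =
      (q : ℚ) ^ k / k.factorial := by
  have h := Finset.sum_pow_eq_sum_piAntidiag (univ : Finset (Fin q)) (fun _ => (1 : ℚ)) k
  simp only [sum_const, card_univ, Fintype.card_fin, nsmul_eq_mul, mul_one, one_pow,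
    prod_const_one] at h
  rw [h, Finset.sum_div]
  refine Finset.sum_congr ?_ ?_
  · ext t
    simp only [mem_filter, Fintype.mem_piFinset, mem_range, mem_piAntidiag, mem_univ, implies_true,
      and_true, and_iff_right_iff_imp]
    rintro h j
    have := Finset.single_le_sum (f := t) (fun _ _ => Nat.zero_le _) (mem_univ j)
    omega
  · intro t ht
    have hs := (mem_piAntidiag.1 ht).1
    have := Nat.multinomial_spec (univ : Finset (Fin q)) t
    rw [hs] at this
    have h2 := congrArg (Nat.cast : ℕ → ℚ) this
    push_cast at h2
    have hk0 : (k.factorial : ℚ) ≠ 0 := by exact_mod_cast k.factorial_ne_zero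
    have hp : (∏ j : Fin q, ((t j).factorial : ℚ)) ≠ 0 :=
      Finset.prod_ne_zero_iff.2 fun j _ => by exact_mod_cast (t j).factorial_ne_zero
    rw [← h2]
    rw [← h2] at hk0
    field_simp
    try exact (div_self (right_ne_zero_of_mul hk0)).symm

theorem stmt_15 {q n : ℕ} (hq : IsPrimePow q) (hn : 1 ≤ n)
    (F : Type*) [Field F] [Fintype F] (hcard : Fintype.card F = q) :
    (Set.ncard {f : (Fin n → F) → F |
        ∃ (i : Fin n) (a b : F), IsCanalyzing f i a b} : ℚ) =
      (∑ k ∈ Finset.Icc 1 q, (-1 : ℚ) ^ (k - 1) *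
        ((n : ℚ) * (q.factorial : ℚ) / ((q - k).factorial : ℚ) *
          (q : ℚ) ^ ((q - k) * q ^ (n - 1)) *
          ∑ t ∈ (Fintype.piFinset fun _ : Fin q => Finset.range (q + 1)) |>.filter
              (fun t => ∑ j : Fin q, t j = k),
            (∏ j : Fin q, ((t j).factorial : ℚ))⁻¹)) +
      ∑ k ∈ Finset.Icc 1 (n * q), (-1 : ℚ) ^ (k - 1) *
        ((q : ℚ) * ∑ v ∈ (Fintype.piFinset fun _ : Fin n => Finset.range (q + 1)) |>.filter
              (fun v => (∑ j : Fin n, v j) = k ∧ ∀ j : Fin n, v j ≤ k - 1),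
            (∏ j : Fin n, (q.choose (v j) : ℚ)) * (q : ℚ) ^ (∏ j : Fin n, (q - v j))) := by
  classical
  obtain ⟨m, rfl⟩ : ∃ m, n = m + 1 := ⟨n - 1, by omega⟩
  have hsign : ∀ k, 1 ≤ k → (-1 : ℚ) ^ (k - 1) = - (-1) ^ k := by
    intro k hk
    obtain ⟨l, rfl⟩ : ∃ l, k = l + 1 := ⟨k - 1, by omega⟩
    simp [pow_succ]
  set Q : ℚ := (q : ℚ) ^ (q ^ m) with hQ
  set T : ℚ := (q : ℚ) ^ (q ^ (m + 1)) with hT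
  have hTQ : T = Q ^ q := by
    rw [hT, hQ, ← pow_mul, ← pow_succ]
  have hcardT : (Fintype.card ((Fin (m+1) → F) → F) : ℚ) = T := by
    simp [hcard, hT]
  -- first sum
  have hU : (∑ k ∈ Finset.Icc 1 q, (-1 : ℚ) ^ (k - 1) *
        (((m + 1 : ℕ) : ℚ) * (q.factorial : ℚ) / ((q - k).factorial : ℚ) *
          (q : ℚ) ^ ((q - k) * q ^ (m + 1 - 1)) *
          ∑ t ∈ (Fintype.piFinset fun _ : Fin q => Finset.range (q + 1)) |>.filter
              (fun t => ∑ j : Fin q, t j = k),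
            (∏ j : Fin q, ((t j).factorial : ℚ))⁻¹)) =
      ((m + 1 : ℕ) : ℚ) * (T - (Q - q) ^ q) := by
    have := binom_Icc q Q q
    rw [hTQ, ← neg_sub, this, ← Finset.sum_neg_distrib, Finset.mul_sum]
    refine Finset.sum_congr rfl fun k hk => ?_
    obtain ⟨hk1, hk2⟩ := Finset.mem_Icc.1 hk
    rw [multinom hk2, hsign k hk1, Nat.cast_choose ℚ hk2, hQ, ← pow_mul,
      Nat.add_sub_cancel, mul_comm (q ^ m) (q - k)]
    field_simp
  -- second sum
  have hV : ∀ b : F, (∑ k ∈ Finset.Icc 1 ((m + 1) * q), (-1 : ℚ) ^ (k - 1) *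
        ((q : ℚ) * ∑ v ∈ (Fintype.piFinset fun _ : Fin (m + 1) => Finset.range (q + 1)) |>.filter
              (fun v => (∑ j : Fin (m + 1), v j) = k ∧ ∀ j : Fin (m + 1), v j ≤ k - 1),
            (∏ j : Fin (m + 1), (q.choose (v j) : ℚ)) *
              (q : ℚ) ^ (∏ j : Fin (m + 1), (q - v j)))) =
      (q : ℚ) * (T - ((Finset.univ.filter (fun f : (Fin (m+1) → F) → F =>
        ∀ i a, ¬ IsCanalyzing f i a b)).card : ℚ) -
          ((m + 1 : ℕ) : ℚ) * (T - (Q - 1) ^ q)) := by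
    intro b
    have h := incl_excl (n := m + 1) b
    rw [hcard, split_sum] at h
    simp only [single_W] at h
    have hb := binom_Icc q Q 1
    have hb' : ∑ k ∈ Finset.Icc 1 q, (q.choose k : ℚ) * ((-1) ^ k * (q : ℚ) ^ ((q - k) * q ^ m)) =
        (Q - 1) ^ q - T := by
      rw [hTQ, hb]
      refine Finset.sum_congr rfl fun k _ => ?_
      rw [hQ, ← pow_mul, mul_comm (q ^ m) (q - k), one_pow, mul_one]
    rw [hb'] at h
    have h0 : (∏ j, (q.choose ((0 : Fin (m+1) → ℕ) j) : ℚ)) *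
      ((-1) ^ (∑ j, (0 : Fin (m+1) → ℕ) j) *
        (q : ℚ) ^ (∏ j, (q - (0 : Fin (m+1) → ℕ) j))) = T := by
      simp [hT]
    rw [h0] at h
    simp only [Finset.sum_const, Finset.card_univ, Fintype.card_fin, nsmul_eq_mul] at h
    rw [h]
    have hs : ∀ X : ℚ, (q : ℚ) * (T - (X + T + ((m + 1 : ℕ) : ℚ) * ((Q - 1) ^ q - T)) -
        ((m + 1 : ℕ) : ℚ) * (T - (Q - 1) ^ q)) = q * (- X) := by
      intro X
      ring
    rw [hs, ← Finset.sum_neg_distrib, Finset.mul_sum]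
    refine Finset.sum_congr rfl fun k hk => ?_
    rw [hsign k (Finset.mem_Icc.1 hk).1, mul_left_comm]
    congr 1
    rw [Finset.mul_sum, ← Finset.sum_neg_distrib]
    refine Finset.sum_congr rfl fun v hv => ?_
    rw [(Finset.mem_filter.1 hv).2.1]
    ring
  -- left-hand side
  have hL : (Set.ncard {f : (Fin (m+1) → F) → F |
        ∃ (i : Fin (m+1)) (a b : F), IsCanalyzing f i a b} : ℚ) =
      ∑ f : (Fin (m+1) → F) → F, if ∃ i a b, IsCanalyzing f i a b then (1 : ℚ) else 0 := by
    rw [Set.ncard_eq_toFinset_card', Set.toFinset_ofPred, Finset.card_filter]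
    push_cast
    rfl
  rw [hU, hL, Finset.sum_congr rfl (fun f _ => pointwise f), Finset.sum_add_distrib,
    Finset.sum_sub_distrib, Finset.sum_comm]
  have a1 : ∑ b : F, ∑ f : (Fin (m+1) → F) → F,
      (if ∃ i a, IsCanalyzing f i a b then (1 : ℚ) else 0) =
      ∑ b : F, (T - ((Finset.univ.filter (fun f : (Fin (m+1) → F) → F =>
        ∀ i a, ¬ IsCanalyzing f i a b)).card : ℚ)) := by
    refine Finset.sum_congr rfl fun b _ => ?_
    rw [count_compl _ (fun f => ∀ i a, ¬ IsCanalyzing f i a b) (by simp), hcardT]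
  have a2 : ∑ f : (Fin (m+1) → F) → F, ∑ b : F, ∑ i,
      (if ∃ a, IsCanalyzing f i a b then (1 : ℚ) else 0) =
      ∑ b : F, ((m + 1 : ℕ) : ℚ) * (T - (Q - 1) ^ q) := by
    rw [Finset.sum_comm]
    refine Finset.sum_congr rfl fun b _ => ?_
    rw [Finset.sum_comm]
    have : ∀ i : Fin (m+1), (∑ f : (Fin (m+1) → F) → F,
        if ∃ a, IsCanalyzing f i a b then (1 : ℚ) else 0) = T - (Q - 1) ^ q := by
      intro i
      rw [count_compl _ (fun f => ∀ a, ¬ IsCanalyzing f i a b) (by simp), hcardT]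
      rw [no_canal_ib, hcard]
    simp only [this, Finset.sum_const, Finset.card_univ, Fintype.card_fin, nsmul_eq_mul]
  have a3 : ∑ f : (Fin (m+1) → F) → F, ∑ i,
      (if ∃ a b, IsCanalyzing f i a b then (1 : ℚ) else 0) =
      ((m + 1 : ℕ) : ℚ) * (T - (Q - q) ^ q) := by
    rw [Finset.sum_comm]
    have : ∀ i : Fin (m+1), (∑ f : (Fin (m+1) → F) → F,
        if ∃ a b, IsCanalyzing f i a b then (1 : ℚ) else 0) = T - (Q - q) ^ q := by
      intro i
      rw [count_compl _ (fun f => ∀ a b, ¬ IsCanalyzing f i a b) (by simp), hcardT]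
      rw [no_canal_i, hcard]
    simp only [this, Finset.sum_const, Finset.card_univ, Fintype.card_fin, nsmul_eq_mul]
  rw [a1, a2, a3, add_comm, ← Finset.sum_sub_distrib]
  congr 1
  have hq0 : (q : ℚ) ≠ 0 := by exact_mod_cast hq.ne_zero
  have hconst : ∀ b : F, (T - ((Finset.univ.filter (fun f : (Fin (m+1) → F) → F =>
        ∀ i a, ¬ IsCanalyzing f i a b)).card : ℚ)) - ((m + 1 : ℕ) : ℚ) * (T - (Q - 1) ^ q) =
      _ / (q : ℚ) := fun b => (eq_div_iff hq0).2 ((mul_comm _ _).trans (hV b).symm)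
  rw [Finset.sum_congr rfl (fun b _ => hconst b), Finset.sum_const, Finset.card_univ, hcard,
    nsmul_eq_mul, mul_div_cancel₀ _ hq0]
end

section
/- Let F = F₂ be the field with 2 elements and n ≥ 1. The number of canalyzing functions f : F₂ⁿ → F₂ (i.e. functions that are ⟨i:a:b⟩ canalyzing for some i ∈ {1,…,n}, a ∈ F₂, b ∈ F₂) equals −4n + Σ_{k=1}^{n} (−1)^(k+1) C(n,k) 2^(k+1) 2^(2^(n−k)) + Σ_{k=3}^{2n} (−1)^(k−1) Σ_{t=1}^{⌊k/2⌋} C(n,t) C(n−t, k−2t) 2^(k−2t+1), where C(m,j) is the binomial coefficient (with C(m,j) = 0 when j > m) and the last double sum is interpreted as 0 when n = 1. -/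
open Finset in
lemma dbl_aux (n : ℕ) (hn : 1 ≤ n) :
    ∑ k ∈ Finset.Icc 3 (2 * n), (-1 : ℤ) ^ (k - 1) *
        ∑ t ∈ Finset.Icc 1 (k / 2),
          (n.choose t : ℤ) * ((n - t).choose (k - 2 * t) : ℤ) * 2 ^ (k - 2 * t + 1)
      = 2 * (-1) ^ n + 2 * n := by
  have h1 : ∑ k ∈ Finset.range (2 * n + 1), ∑ t ∈ Finset.Icc 1 (k / 2),
      (n.choose t : ℤ) * ((n - t).choose (k - 2 * t) : ℤ) * (-2) ^ (k - 2 * t) = - (-1) ^ n := by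
    rw [Finset.sum_comm' (t' := Finset.Icc 1 n) (s' := fun t => Finset.Ico (2 * t) (2 * n + 1))
      (by intro x y; simp only [Finset.mem_range, Finset.mem_Icc, Finset.mem_Ico]; omega)]
    have h2 : ∀ t ∈ Finset.Icc 1 n, ∑ k ∈ Finset.Ico (2 * t) (2 * n + 1),
        (n.choose t : ℤ) * ((n - t).choose (k - 2 * t) : ℤ) * (-2) ^ (k - 2 * t)
        = (n.choose t : ℤ) * (-1) ^ (n - t) := by
      intro t ht
      rw [Finset.mem_Icc] at ht
      rw [Finset.sum_Ico_eq_sum_range]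
      have h3 : ((-1 : ℤ)) ^ (n - t) = (-2 + 1) ^ (n - t) := by norm_num
      rw [h3, add_pow, Finset.mul_sum]
      symm
      have hsub : Finset.range (n - t + 1) ⊆ Finset.range (2 * n + 1 - 2 * t) := by
        intro x; simp only [Finset.mem_range]; omega
      rw [← Finset.sum_subset hsub]
      · apply Finset.sum_congr rfl
        intro j _
        rw [Nat.add_sub_cancel_left]; ring
      · intro j _ hj
        rw [Finset.mem_range] at hj
        rw [Nat.add_sub_cancel_left, Nat.choose_eq_zero_of_lt (by omega : n - t < j)]
        simp
    rw [Finset.sum_congr rfl h2]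
    have h4 : (0 : ℤ) = (1 + -1) ^ n := by
      rw [add_neg_cancel, zero_pow (by omega)]
    rw [add_pow, Finset.sum_range_succ'] at h4
    have h5 : ∑ t ∈ Finset.Icc 1 n, (n.choose t : ℤ) * (-1) ^ (n - t)
        = ∑ k ∈ Finset.range n, 1 ^ (k + 1) * (-1 : ℤ) ^ (n - (k + 1)) * (n.choose (k + 1) : ℤ) := by
      rw [← Finset.Ico_add_one_right_eq_Icc, Finset.sum_Ico_eq_sum_range]
      apply Finset.sum_congr rfl
      intro k _
      rw [add_comm 1 k]; ring
    rw [h5]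
    simp at h4 ⊢
    linarith
  have h6 : ∀ k ∈ Finset.Icc 3 (2 * n), (-1 : ℤ) ^ (k - 1) *
        ∑ t ∈ Finset.Icc 1 (k / 2),
          (n.choose t : ℤ) * ((n - t).choose (k - 2 * t) : ℤ) * 2 ^ (k - 2 * t + 1)
      = -2 * ∑ t ∈ Finset.Icc 1 (k / 2),
      (n.choose t : ℤ) * ((n - t).choose (k - 2 * t) : ℤ) * (-2) ^ (k - 2 * t) := by
    intro k hk
    rw [Finset.mem_Icc] at hk
    rw [Finset.mul_sum, Finset.mul_sum]
    apply Finset.sum_congr rfl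
    intro t ht
    rw [Finset.mem_Icc] at ht
    obtain ⟨j, rfl⟩ : ∃ j, k = 2 * t + j := ⟨k - 2 * t, by omega⟩
    rw [Nat.add_sub_cancel_left]
    have h7 : (-1 : ℤ) ^ (2 * t + j - 1) = - (-1) ^ j := by
      obtain ⟨s, rfl⟩ : ∃ s, t = s + 1 := ⟨t - 1, by omega⟩
      rw [show 2 * (s + 1) + j - 1 = 2 * s + (j + 1) by omega, pow_add, pow_mul]
      simp [pow_succ]
    rw [h7, show (-2 : ℤ) ^ j = (-1) ^ j * 2 ^ j by rw [← mul_pow]; norm_num]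
    ring
  rw [Finset.sum_congr rfl h6, ← Finset.mul_sum]
  rw [Finset.range_eq_Ico, ← Finset.sum_Ico_consecutive _ (Nat.zero_le 3) (by omega : 3 ≤ 2 * n + 1),
    Finset.Ico_add_one_right_eq_Icc] at h1
  rw [← Finset.range_eq_Ico, Finset.sum_range_succ, Finset.sum_range_succ, Finset.sum_range_succ] at h1
  simp at h1
  linarith

lemma grp_aux (φ : ℕ → ℤ) (h0 : φ 0 = 0) (n : ℕ) : ∀ c : ℕ,
    ∑ g : Fin n → Finset (ZMod 2), (∏ i, (-1 : ℤ) ^ (g i).card) * φ (c * ∏ i, (g i)ᶜ.card)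
    = ∑ k ∈ Finset.range (n + 1), (n.choose k : ℤ) * (-2) ^ k * φ (c * 2 ^ (n - k)) := by
  induction n with
  | zero => intro c; simp
  | succ n ih =>
    intro c
    rw [← (Fin.consEquiv (fun _ : Fin (n + 1) => Finset (ZMod 2))).sum_comp, Fintype.sum_prod_type]
    have e : ∀ s : Finset (ZMod 2), ∑ y : Fin n → Finset (ZMod 2),
        (∏ i, (-1 : ℤ) ^ ((Fin.consEquiv (fun _ : Fin (n + 1) => Finset (ZMod 2))) (s, y) i).card) *
         φ (c * ∏ i, ((Fin.consEquiv (fun _ : Fin (n + 1) => Finset (ZMod 2))) (s, y) i)ᶜ.card)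
        = (-1) ^ s.card * ∑ k ∈ Finset.range (n + 1),
          (n.choose k : ℤ) * (-2) ^ k * φ ((c * sᶜ.card) * 2 ^ (n - k)) := by
      intro s
      rw [← ih, Finset.mul_sum]
      apply Finset.sum_congr rfl
      intro y _
      simp [Fin.consEquiv, Fin.prod_univ_succ, mul_assoc]
    rw [Finset.sum_congr rfl (fun s _ => e s)]
    have hu : (Finset.univ : Finset (Finset (ZMod 2))) = {∅, {0}, {1}, {0, 1}} := by decide
    rw [hu, Finset.sum_insert (by decide), Finset.sum_insert (by decide),
      Finset.sum_insert (by decide), Finset.sum_singleton]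
    have c1 : (∅ᶜ : Finset (ZMod 2)).card = 2 := by decide
    have c2 : ({0}ᶜ : Finset (ZMod 2)).card = 1 := by decide
    have c3 : ({1}ᶜ : Finset (ZMod 2)).card = 1 := by decide
    have c4 : ({0, 1}ᶜ : Finset (ZMod 2)).card = 0 := by decide
    have c5 : ({0, 1} : Finset (ZMod 2)).card = 2 := by decide
    rw [c1, c2, c3, c4, c5]
    simp only [Finset.card_empty, Finset.card_singleton, mul_zero, zero_mul, h0, mul_one,
      Finset.sum_const_zero, add_zero, pow_zero, one_mul, pow_one]
    rw [Finset.sum_range_succ' _ (n + 1)]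
    simp only [Nat.choose_succ_succ, Nat.cast_add, add_mul, Finset.sum_add_distrib,
      Nat.add_sub_add_right]
    have r1 : ∑ k ∈ Finset.range (n + 1), (n.choose k : ℤ) * (-2) ^ (k + 1) * φ (c * 2 ^ (n - k))
       = -2 * ∑ k ∈ Finset.range (n + 1), (n.choose k : ℤ) * (-2) ^ k * φ (c * 2 ^ (n - k)) := by
      rw [Finset.mul_sum]; apply Finset.sum_congr rfl; intros; ring
    have r2 : ∑ k ∈ Finset.range (n + 1), (n.choose k : ℤ) * (-2) ^ k * φ (c * 2 * 2 ^ (n - k))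
       = ∑ k ∈ Finset.range (n + 1),
          (n.choose (k + 1) : ℤ) * (-2) ^ (k + 1) * φ (c * 2 ^ (n - k)) + φ (c * 2 ^ (n + 1)) := by
      rw [Finset.sum_range_succ', Finset.sum_range_succ _ n]
      simp only [Nat.choose_succ_self, Nat.cast_zero, zero_mul, add_zero, Nat.choose_zero_right]
      congr 1
      · apply Finset.sum_congr rfl
        intro k hk
        rw [Finset.mem_range] at hk
        rw [show n - k = n - (k + 1) + 1 by omega, pow_succ]
        congr 2; ring
      · rw [Nat.sub_zero, pow_succ]; simp; congr 1; ring
    rw [r1, r2]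
    simp
    ring

open Classical in
lemma cnt_aux {n : ℕ} (b : ZMod 2) (g : Fin n → Finset (ZMod 2)) :
    (Finset.univ.filter (fun f : (Fin n → ZMod 2) → ZMod 2 =>
      ∀ i, ∀ a ∈ g i, IsCanalyzing f i a b)).card = 2 ^ (∏ i, (g i)ᶜ.card) := by
  have h1 : (Finset.univ.filter (fun f : (Fin n → ZMod 2) → ZMod 2 =>
      ∀ i, ∀ a ∈ g i, IsCanalyzing f i a b)) =
      Fintype.piFinset (fun x : Fin n → ZMod 2 =>
        if x ∈ Fintype.piFinset (fun i => (g i)ᶜ) then Finset.univ else {b}) := by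
    ext f
    simp only [Finset.mem_filter, Finset.mem_univ, true_and, Fintype.mem_piFinset]
    constructor
    · intro h x
      split_ifs with hx
      · simp
      · simp only [Finset.mem_compl, not_forall, not_not] at hx
        obtain ⟨i, hi⟩ := hx
        have := h i _ hi x
        simpa using this
    · intro h i a ha x
      have := h (Function.update x i a)
      rw [if_neg] at this
      · simpa using this
      · intro hh
        have := hh i
        simp at this
        exact this ha
  rw [h1, Fintype.card_piFinset]
  have h2 : ∀ x : Fin n → ZMod 2, (if x ∈ Fintype.piFinset (fun i => (g i)ᶜ)
      then (Finset.univ : Finset (ZMod 2)) else {b}).card =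
      if x ∈ Fintype.piFinset (fun i => (g i)ᶜ) then 2 else 1 := by
    intro x; split_ifs <;> simp
  rw [Finset.prod_congr rfl (fun x _ => h2 x), ← Fintype.card_piFinset]
  rw [Finset.prod_ite_mem]
  simp

open Classical in
lemma no_aux {n : ℕ} (hn : 1 ≤ n) (b : ZMod 2) :
    ((Finset.univ.filter (fun f : (Fin n → ZMod 2) → ZMod 2 =>
      ¬ ∃ i a, IsCanalyzing f i a b)).card : ℤ) =
      ∑ k ∈ Finset.range (n + 1), (n.choose k : ℤ) * (-2) ^ k * 2 ^ (2 ^ (n - k)) - (-1) ^ n := by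
  have h1 : ((Finset.univ.filter (fun f : (Fin n → ZMod 2) → ZMod 2 =>
      ¬ ∃ i a, IsCanalyzing f i a b)).card : ℤ) =
      ∑ f : (Fin n → ZMod 2) → ZMod 2, ∏ i, ∏ a,
        (1 + (- if IsCanalyzing f i a b then (1 : ℤ) else 0)) := by
    rw [Finset.card_filter, Nat.cast_sum]
    apply Finset.sum_congr rfl
    intro f _
    by_cases h : ∃ i a, IsCanalyzing f i a b
    swap
    · rw [if_pos h]
      push Not at h
      simp [h]
    · rw [if_neg (not_not.mpr h)]
      obtain ⟨i, a, h⟩ := h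
      symm
      rw [Nat.cast_zero]
      apply Finset.prod_eq_zero (Finset.mem_univ i)
      apply Finset.prod_eq_zero (Finset.mem_univ a)
      simp [h]
  have h2 : ∀ f : (Fin n → ZMod 2) → ZMod 2, ∏ i, ∏ a,
        (1 + (- if IsCanalyzing f i a b then (1 : ℤ) else 0)) =
      ∑ g : Fin n → Finset (ZMod 2), (∏ i, (-1 : ℤ) ^ (g i).card) *
        if (∀ i, ∀ a ∈ g i, IsCanalyzing f i a b) then 1 else 0 := by
    intro f
    simp only [Finset.prod_one_add, Finset.powerset_univ]
    rw [Finset.prod_univ_sum, Fintype.piFinset_univ]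
    apply Finset.sum_congr rfl
    intro g _
    simp only [Finset.prod_neg, Finset.prod_mul_distrib]
    congr 1
    split_ifs with h
    · apply Finset.prod_eq_one; intro i _
      apply Finset.prod_eq_one; intro a ha
      simp [h i a ha]
    · push Not at h
      obtain ⟨i, a, ha, h⟩ := h
      apply Finset.prod_eq_zero (Finset.mem_univ i)
      apply Finset.prod_eq_zero ha
      simp [h]
  rw [h1, Finset.sum_congr rfl (fun f _ => h2 f), Finset.sum_comm]
  have h3 : ∀ g : Fin n → Finset (ZMod 2),
      ∑ f : (Fin n → ZMod 2) → ZMod 2, (∏ i, (-1 : ℤ) ^ (g i).card) *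
        (if (∀ i, ∀ a ∈ g i, IsCanalyzing f i a b) then (1 : ℤ) else 0)
      = (∏ i, (-1 : ℤ) ^ (g i).card) * (2 ^ (1 * ∏ i, (g i)ᶜ.card) - 1) +
        ∏ i, (-1 : ℤ) ^ (g i).card := by
    intro g
    have := cnt_aux b g
    rw [Finset.card_filter] at this
    rw [← Finset.mul_sum]
    have h4 : ∑ f : (Fin n → ZMod 2) → ZMod 2,
      (if (∀ i, ∀ a ∈ g i, IsCanalyzing f i a b) then (1 : ℤ) else 0) =
        2 ^ (∏ i, (g i)ᶜ.card) := by
      exact_mod_cast this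
    rw [h4]; ring
  rw [Finset.sum_congr rfl (fun g _ => h3 g), Finset.sum_add_distrib,
    grp_aux (fun m => 2 ^ m - 1) (by simp) n 1]
  have h5 : ∑ g : Fin n → Finset (ZMod 2), ∏ i, (-1 : ℤ) ^ (g i).card = 0 := by
    rw [← Fintype.piFinset_univ, ← Finset.prod_univ_sum (fun _ : Fin n => Finset.univ)
      (fun _ (s : Finset (ZMod 2)) => (-1 : ℤ) ^ s.card)]
    apply Finset.prod_eq_zero (Finset.mem_univ (⟨0, hn⟩ : Fin n))
    decide
  have h6 : (-1 : ℤ) ^ n = (-2 + 1) ^ n := by norm_num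
  rw [h5, h6, add_pow, ← Finset.sum_sub_distrib, add_zero]
  apply Finset.sum_congr rfl
  intro k _
  simp only [one_mul, one_pow]
  ring

open Classical in
lemma int_aux {n : ℕ} :
    (Finset.univ.filter (fun f : (Fin n → ZMod 2) → ZMod 2 =>
      (∃ i a, IsCanalyzing f i a 0) ∧ (∃ i a, IsCanalyzing f i a 1))).card = 2 * n := by
  have h1 : Finset.univ.filter (fun f : (Fin n → ZMod 2) → ZMod 2 =>
      (∃ i a, IsCanalyzing f i a 0) ∧ (∃ i a, IsCanalyzing f i a 1)) =
      (Finset.univ : Finset (Fin n × ZMod 2)).image (fun p => fun x => x p.1 + p.2) := by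
    ext f
    simp only [Finset.mem_filter, Finset.mem_univ, true_and, Finset.mem_image, Prod.exists]
    constructor
    · rintro ⟨⟨i, a, h⟩, ⟨j, c, h'⟩⟩
      have hij : i = j := by
        by_contra hne
        have e1 := h (Function.update 0 j c)
        have e2 := h' (Function.update 0 i a)
        rw [Function.update_comm hne, e1] at e2
        exact absurd e2 (by decide)
      subst hij
      have hac : a ≠ c := by
        rintro rfl
        have e1 := h 0
        rw [h' 0] at e1
        exact absurd e1 (by decide)
      refine ⟨i, a, ?_⟩
      funext x
      by_cases hx : x i = a
      · have := h x
        rw [← hx, Function.update_eq_self] at this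
        rw [this, hx]
        clear * -
        revert a; decide
      · have hxc : x i = c := by
          generalize x i = y at hx
          clear h h'
          revert a c y; decide
        have := h' x
        rw [← hxc, Function.update_eq_self] at this
        rw [this, hxc]
        clear * - hac
        revert a c; decide
    · rintro ⟨i, a, rfl⟩
      refine ⟨⟨i, a, ?_⟩, ⟨i, a + 1, ?_⟩⟩
      · intro x
        simp only [Function.update_self]
        revert a; decide
      · intro x
        simp only [Function.update_self]
        revert a; decide
  rw [h1, Finset.card_image_of_injective]
  · simp [mul_comm]
  · rintro ⟨i, a⟩ ⟨j, c⟩ h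
    have e0 := congrFun h 0
    have e1 := congrFun h (Pi.single i 1)
    simp at e0
    subst e0
    simp [Pi.single_apply] at e1
    simp [e1]

theorem stmt_16 {n : ℕ} (hn : 1 ≤ n) :
    (Set.ncard {f : (Fin n → ZMod 2) → ZMod 2 |
        ∃ (i : Fin n) (a b : ZMod 2), IsCanalyzing f i a b} : ℤ) =
      -4 * (n : ℤ) +
      (∑ k ∈ Finset.Icc 1 n,
        (-1 : ℤ) ^ (k + 1) * (n.choose k : ℤ) * 2 ^ (k + 1) * 2 ^ (2 ^ (n - k))) +
      ∑ k ∈ Finset.Icc 3 (2 * n), (-1 : ℤ) ^ (k - 1) *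
        ∑ t ∈ Finset.Icc 1 (k / 2),
          (n.choose t : ℤ) * ((n - t).choose (k - 2 * t) : ℤ) * 2 ^ (k - 2 * t + 1) := by
  classical
  rw [dbl_aux n hn]
  have hs : {f : (Fin n → ZMod 2) → ZMod 2 |
        ∃ (i : Fin n) (a b : ZMod 2), IsCanalyzing f i a b} =
      ((Finset.univ.filter (fun f : (Fin n → ZMod 2) → ZMod 2 => ∃ i a, IsCanalyzing f i a 0) ∪
       Finset.univ.filter (fun f : (Fin n → ZMod 2) → ZMod 2 => ∃ i a, IsCanalyzing f i a 1) :
        Finset ((Fin n → ZMod 2) → ZMod 2)) : Set ((Fin n → ZMod 2) → ZMod 2)) := by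
    ext f
    simp only [Set.mem_ofPred_eq, Finset.coe_union, Finset.coe_filter, Finset.mem_univ, true_and,
      Set.mem_union]
    constructor
    · rintro ⟨i, a, b, h⟩
      have hb : b = 0 ∨ b = 1 := by clear h; revert b; decide
      rcases hb with rfl | rfl
      · exact Or.inl ⟨i, a, h⟩
      · exact Or.inr ⟨i, a, h⟩
    · rintro (⟨i, a, h⟩ | ⟨i, a, h⟩)
      · exact ⟨i, a, _, h⟩
      · exact ⟨i, a, _, h⟩
  rw [hs, Set.ncard_coe_finset]
  have hu := Finset.card_union_add_card_inter
    (Finset.univ.filter (fun f : (Fin n → ZMod 2) → ZMod 2 => ∃ i a, IsCanalyzing f i a 0))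
    (Finset.univ.filter (fun f : (Fin n → ZMod 2) → ZMod 2 => ∃ i a, IsCanalyzing f i a 1))
  rw [← Finset.filter_and, int_aux] at hu
  have hc : ∀ b : ZMod 2, ((Finset.univ.filter
      (fun f : (Fin n → ZMod 2) → ZMod 2 => ∃ i a, IsCanalyzing f i a b)).card : ℤ) =
      2 ^ (2 ^ n) - (∑ k ∈ Finset.range (n + 1), (n.choose k : ℤ) * (-2) ^ k * 2 ^ (2 ^ (n - k))
        - (-1) ^ n) := by
    intro b
    rw [← no_aux hn b]
    have := Finset.card_filter_add_card_filter_not (s := Finset.univ)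
      (fun f : (Fin n → ZMod 2) → ZMod 2 => ∃ i a, IsCanalyzing f i a b)
    have hcard : (Finset.univ : Finset ((Fin n → ZMod 2) → ZMod 2)).card = 2 ^ (2 ^ n) := by
      simp
    rw [hcard] at this
    zify at this
    linarith
  zify at hu
  rw [hc, hc] at hu
  have hr : ∑ k ∈ Finset.range (n + 1), (n.choose k : ℤ) * (-2) ^ k * 2 ^ (2 ^ (n - k)) =
      2 ^ (2 ^ n) + ∑ k ∈ Finset.Icc 1 n, (n.choose k : ℤ) * (-2) ^ k * 2 ^ (2 ^ (n - k)) := by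
    rw [Finset.range_eq_Ico, Finset.sum_eq_sum_Ico_succ_bot (by omega)]
    rw [zero_add, Finset.Ico_add_one_right_eq_Icc]
    simp
  have hk : ∑ k ∈ Finset.Icc 1 n,
        (-1 : ℤ) ^ (k + 1) * (n.choose k : ℤ) * 2 ^ (k + 1) * 2 ^ (2 ^ (n - k)) =
      -2 * ∑ k ∈ Finset.Icc 1 n, (n.choose k : ℤ) * (-2) ^ k * 2 ^ (2 ^ (n - k)) := by
    rw [Finset.mul_sum]
    apply Finset.sum_congr rfl
    intro k _
    rw [show (-2 : ℤ) ^ k = (-1) ^ k * 2 ^ k by rw [← mul_pow]; norm_num]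
    ring
  rw [hk]
  rw [hr] at hu
  linarith
end

section
/- For every positive integer n, Σ_{k=3}^{2n} (−1)^(k−1) Σ_{t=1}^{⌊k/2⌋} C(n,t) · C(n−t, k−2t) · 2^(k−2t+1) = 2((−1)ⁿ + n), where C(m,j) denotes the binomial coefficient (with C(m,j) = 0 when j > m) and the left-hand side is interpreted as 0 when n = 1. -/
lemma aux_binom (m N : ℕ) (h : m < N) :
    ∑ j ∈ Finset.range N, (m.choose j : ℤ) * (-2) ^ j = (-1) ^ m := by
  have h1 : ∑ j ∈ Finset.range (m + 1), (m.choose j : ℤ) * (-2) ^ j = (-1) ^ m := by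
    have := add_pow (-2 : ℤ) 1 m
    norm_num at this
    rw [this]
    exact Finset.sum_congr rfl fun j _ => by ring
  rw [← h1]
  symm
  apply Finset.sum_subset
  · intro j hj
    simp only [Finset.mem_range] at *
    omega
  · intro j _ hj
    simp only [Finset.mem_range] at *
    rw [Nat.choose_eq_zero_of_lt (by omega)]
    simp

theorem stmt_17 (n : ℕ) (hn : 1 ≤ n) :
    (∑ k ∈ Finset.Icc 3 (2 * n), (-1 : ℤ) ^ (k - 1) *
        ∑ t ∈ Finset.Icc 1 (k / 2),
          (n.choose t : ℤ) * ((n - t).choose (k - 2 * t) : ℤ) * 2 ^ (k - 2 * t + 1)) =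
      2 * ((-1 : ℤ) ^ n + (n : ℤ)) := by
  set G : ℕ → ℤ := fun k => ∑ t ∈ Finset.Icc 1 n, if 2 * t ≤ k then
    (n.choose t : ℤ) * (((n - t).choose (k - 2 * t) : ℤ) * (-2) ^ (k - 2 * t)) else 0 with hG
  have hterm : ∀ k ∈ Finset.Ico 3 (2 * n + 1), (-1 : ℤ) ^ (k - 1) *
        ∑ t ∈ Finset.Icc 1 (k / 2),
          (n.choose t : ℤ) * ((n - t).choose (k - 2 * t) : ℤ) * 2 ^ (k - 2 * t + 1)
        = -2 * G k := by
    intro k hk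
    rw [Finset.mem_Ico] at hk
    simp only [hG]
    rw [← Finset.sum_filter]
    have hs : (Finset.Icc 1 n).filter (fun t => 2 * t ≤ k) = Finset.Icc 1 (k / 2) := by
      ext t
      simp only [Finset.mem_filter, Finset.mem_Icc]
      omega
    rw [hs, Finset.mul_sum, Finset.mul_sum]
    refine Finset.sum_congr rfl fun t ht => ?_
    rw [Finset.mem_Icc] at ht
    obtain ⟨j, rfl⟩ : ∃ j, k = 2 * t + j := ⟨k - 2 * t, by omega⟩
    have e : (-1 : ℤ) ^ (2 * t + j - 1) = - (-1) ^ j := by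
      have h2 : (-1 : ℤ) ^ (2 * t + j - 1 + 1) = (-1) ^ j := by
        rw [Nat.sub_add_cancel (by omega), pow_add, pow_mul]; simp
      rw [pow_succ] at h2
      linarith
    rw [e, Nat.add_sub_cancel_left, show (-2 : ℤ) = (-1) * 2 by norm_num, mul_pow]
    ring
  have hI : Finset.Icc 3 (2 * n) = Finset.Ico 3 (2 * n + 1) := by
    ext; simp only [Finset.mem_Icc, Finset.mem_Ico]; omega
  rw [hI, Finset.sum_congr rfl hterm, ← Finset.mul_sum]
  have hsplit := Finset.sum_range_add_sum_Ico G (show 3 ≤ 2 * n + 1 by omega)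
  have h0 : G 0 = 0 := Finset.sum_eq_zero fun t ht => by
    rw [Finset.mem_Icc] at ht
    rw [if_neg (by omega)]
  have h1 : G 1 = 0 := Finset.sum_eq_zero fun t ht => by
    rw [Finset.mem_Icc] at ht
    rw [if_neg (by omega)]
  have h2 : G 2 = n := by
    simp only [hG]
    rw [Finset.sum_eq_single 1]
    · simp
    · intro t ht hne
      rw [Finset.mem_Icc] at ht
      rw [if_neg (by omega)]
    · intro h
      exact absurd (Finset.mem_Icc.2 ⟨le_rfl, hn⟩) h
  have htot : ∑ k ∈ Finset.range (2 * n + 1), G k = - (-1) ^ n := by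
    simp only [hG]
    rw [Finset.sum_comm]
    have hin : ∀ t ∈ Finset.Icc 1 n, (∑ k ∈ Finset.range (2 * n + 1), if 2 * t ≤ k then
        (n.choose t : ℤ) * (((n - t).choose (k - 2 * t) : ℤ) * (-2) ^ (k - 2 * t)) else 0)
        = (-1) ^ (n - t) * (n.choose t : ℤ) := by
      intro t ht
      rw [Finset.mem_Icc] at ht
      rw [← Finset.sum_filter]
      have hs : (Finset.range (2 * n + 1)).filter (fun k => 2 * t ≤ k)
          = Finset.Ico (2 * t) (2 * n + 1) := by
        ext k
        simp only [Finset.mem_filter, Finset.mem_range, Finset.mem_Ico]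
        omega
      rw [hs, Finset.sum_Ico_eq_sum_range]
      simp only [Nat.add_sub_cancel_left]
      rw [← Finset.mul_sum, aux_binom _ _ (by omega)]
      ring
    rw [Finset.sum_congr rfl hin]
    have hb := add_pow (1 : ℤ) (-1) n
    rw [Finset.sum_range_eq_add_Ico _ (by omega)] at hb
    have hI2 : Finset.Icc 1 n = Finset.Ico 1 (n + 1) := by
      ext; simp only [Finset.mem_Icc, Finset.mem_Ico]; omega
    rw [hI2]
    simp [show n ≠ 0 by omega] at hb
    linarith
  simp only [Finset.sum_range_succ _ 2, Finset.sum_range_succ _ 1, Finset.sum_range_succ _ 0, Finset.sum_range_zero] at hsplit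
  rw [h0, h1, h2, htot] at hsplit
  linarith
end

section
/- Fix a prime power q and the finite field F = F_q with q elements. For each n ≥ 1 let c(n) denote the number of canalyzing functions f : Fⁿ → F (i.e. functions that are ⟨i:a:b⟩ canalyzing for some i ∈ {1,…,n}, a ∈ F, b ∈ F). Then c(n) is asymptotic to n·q²·q^((q−1)·q^(n−1)) as n → ∞, i.e. lim_{n→∞} c(n) / (n q² q^((q−1)q^(n−1))) = 1. -/
open Finset in
theorem aux_bonf {ι α : Type*} [Fintype ι] [DecidableEq ι] [DecidableEq α] (A : ι → Finset α)
    (M Q : ℕ) (hA : ∀ s, #(A s) = M) (hp : ∀ s t, s ≠ t → #(A s ∩ A t) * Q ≤ M) :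
    Fintype.card ι * M * Q ≤ #(univ.biUnion A) * Q + Fintype.card ι * Fintype.card ι * M := by
  let B : ι → Finset α := fun s => A s \ (univ.erase s).biUnion (fun t => A s ∩ A t)
  have hB : ∀ s, M * Q ≤ #(B s) * Q + Fintype.card ι * M := by
    intro s
    have h1 : #(A s) ≤ #((univ.erase s).biUnion (fun t => A s ∩ A t)) + #(B s) := by
      have := Finset.le_card_sdiff ((univ.erase s).biUnion (fun t => A s ∩ A t)) (A s)
      simp only [B]; omega
    have h2 : #((univ.erase s).biUnion (fun t => A s ∩ A t)) * Q ≤ Fintype.card ι * M := by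
      calc _ ≤ (∑ t ∈ univ.erase s, #(A s ∩ A t)) * Q := by gcongr; exact card_biUnion_le
        _ = ∑ t ∈ univ.erase s, #(A s ∩ A t) * Q := by rw [sum_mul]
        _ ≤ ∑ t ∈ univ.erase s, M := by
            apply sum_le_sum; intro t ht; exact hp s t (ne_of_mem_erase ht).symm
        _ ≤ ∑ t : ι, M := sum_le_sum_of_subset (erase_subset _ _)
        _ = _ := by simp
    rw [hA] at h1
    nlinarith [Nat.mul_le_mul_right Q h1]
  have hd : ∑ s, #(B s) ≤ #(univ.biUnion A) := by
    rw [← card_biUnion]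
    · apply card_le_card
      apply biUnion_mono
      intro s _; exact sdiff_subset
    · intro s _ t _ hst
      change Disjoint (B s) (B t)
      rw [Finset.disjoint_left]
      intro x hx hy
      simp only [B, mem_sdiff, mem_biUnion, mem_erase, mem_univ, mem_inter] at hx hy
      exact hx.2 ⟨t, ⟨hst.symm, trivial⟩, hx.1, hy.1⟩
  have := sum_le_sum (fun s (_ : s ∈ (univ : Finset ι)) => hB s)
  rw [sum_add_distrib] at this
  have hm : ∑ s, #(B s) * Q = (∑ s, #(B s)) * Q := by rw [sum_mul]
  rw [hm] at this
  simp only [sum_const, smul_eq_mul, card_univ] at this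
  nlinarith [Nat.mul_le_mul_right Q hd]

open Finset in
theorem aux_count {X F : Type*} [Fintype X] [DecidableEq X] [Fintype F] [DecidableEq F]
    (T : Finset X) (g : X → F) :
    #{f : X → F | ∀ x ∈ T, f x = g x} = Fintype.card F ^ (Fintype.card X - #T) := by
  have : ({f : X → F | ∀ x ∈ T, f x = g x} : Finset (X → F)) =
      Fintype.piFinset (fun x => if x ∈ T then {g x} else univ) := by
    ext f
    simp only [mem_filter, mem_univ, true_and, Fintype.mem_piFinset]
    refine forall_congr' fun x => ?_
    by_cases h : x ∈ T <;> simp [h]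
  rw [this, Fintype.card_piFinset, ← card_compl]
  rw [← prod_subset (subset_univ Tᶜ)]
  · rw [prod_congr rfl (g := fun _ => Fintype.card F)]
    · simp
    · intro x hx
      simp [mem_compl.1 hx]
  · intro x _ hx
    have : x ∈ T := by simpa using hx
    simp [this]

open Finset in
theorem aux_T {F : Type*} [Fintype F] [DecidableEq F] {N : ℕ} (i : Fin (N+2)) (a : F) :
    #{x : Fin (N+2) → F | x i = a} = Fintype.card F ^ (N+1) := by
  have : ({x : Fin (N+2) → F | x i = a} : Finset _) =
      Fintype.piFinset (fun k => if k = i then {a} else univ) := by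
    ext f
    simp only [mem_filter, mem_univ, true_and, Fintype.mem_piFinset]
    constructor
    · intro h k
      by_cases hk : k = i
      · subst hk; simp [h]
      · simp [hk]
    · intro h; simpa using h i
  rw [this, Fintype.card_piFinset, ← mul_prod_erase univ _ (mem_univ i)]
  rw [prod_congr rfl (g := fun _ => Fintype.card F)]
  · simp
  · intro x hx
    simp [ne_of_mem_erase hx]

open Finset in
theorem aux_R {F : Type*} [Fintype F] [DecidableEq F] {N : ℕ} (i j : Fin (N+2)) (hij : i ≠ j)
    (a c : F) :
    #{x : Fin (N+2) → F | x i = a ∧ x j = c} = Fintype.card F ^ N := by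
  have : ({x : Fin (N+2) → F | x i = a ∧ x j = c} : Finset _) =
      Fintype.piFinset (fun k => if k = i then {a} else if k = j then {c} else univ) := by
    ext f
    simp only [mem_filter, mem_univ, true_and, Fintype.mem_piFinset]
    constructor
    · intro h k
      by_cases hk : k = i
      · subst hk; simp [h]
      · by_cases hk' : k = j
        · subst hk'; simp [h, hk]
        · simp [hk, hk']
    · intro h
      exact ⟨by simpa using h i, by simpa [hij.symm] using h j⟩
  have hj : j ∈ univ.erase i := by simp [hij.symm]
  rw [this, Fintype.card_piFinset, ← mul_prod_erase univ _ (mem_univ i),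
    ← mul_prod_erase _ _ hj]
  rw [prod_congr rfl (g := fun _ => Fintype.card F)]
  · simp [hij.symm, card_erase_of_mem hj]
  · intro x hx
    have h1 := ne_of_mem_erase hx
    have h2 := ne_of_mem_erase (mem_of_mem_erase hx)
    simp [h1, h2]

theorem aux_iff {F : Type*} {n : ℕ} (f : (Fin n → F) → F) (i : Fin n) (a b : F) :
    IsCanalyzing f i a b ↔ ∀ x, x i = a → f x = b := by
  constructor
  · intro h x hx
    have := h x
    rwa [← hx, Function.update_eq_self] at this
  · intro h x
    exact h _ (by simp)

open Finset in
theorem aux_pair {F : Type*} [Fintype F] [DecidableEq F] [Nontrivial F] {N : ℕ}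
    (A : Fin (N+2) × F × F → Finset ((Fin (N+2) → F) → F))
    (hAm : ∀ s f, f ∈ A s ↔ ∀ x, x s.1 = s.2.1 → f x = s.2.2)
    (s t : Fin (N+2) × F × F) (hst : s ≠ t) :
    #(A s ∩ A t) * Fintype.card F ^ (Fintype.card F ^ N) ≤
      Fintype.card F ^ ((Fintype.card F - 1) * Fintype.card F ^ (N+1)) := by
  rcases (A s ∩ A t).eq_empty_or_nonempty with h | ⟨g, hg⟩
  · simp [h]
  obtain ⟨i, a, b⟩ := s
  obtain ⟨j, c, d⟩ := t
  have hq : 1 < Fintype.card F := Fintype.one_lt_card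
  have hgs := (hAm _ _).1 (mem_inter.1 hg).1
  have hgt := (hAm _ _).1 (mem_inter.1 hg).2
  simp only at hgs hgt
  -- the additional constrained points
  have hR : ∃ R : Finset (Fin (N+2) → F), Fintype.card F ^ N ≤ #R ∧
      (∀ x ∈ R, x i ≠ a ∧ x j = c) := by
    by_cases hij : i = j
    · subst hij
      have hac : c ≠ a := by
        rintro rfl
        apply hst
        have h1 := hgs (fun _ => c) rfl
        have h2 := hgt (fun _ => c) rfl
        rw [← h1, ← h2]
      refine ⟨({x : Fin (N+2) → F | x i = c} : Finset _), ?_, ?_⟩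
      · rw [aux_T]; exact Nat.pow_le_pow_right (by omega) (by omega)
      · intro x hx
        have hx' : x i = c := by simpa using hx
        exact ⟨by rw [hx']; exact hac, hx'⟩
    · obtain ⟨a', ha'⟩ := exists_ne a
      refine ⟨({x : Fin (N+2) → F | x i = a' ∧ x j = c} : Finset _), ?_, ?_⟩
      · rw [aux_R i j hij]
      · intro x hx
        have hx' : x i = a' ∧ x j = c := by simpa using hx
        exact ⟨by rw [hx'.1]; exact ha', hx'.2⟩
  obtain ⟨R, hRc, hR⟩ := hR
  set T : Finset (Fin (N+2) → F) := ({x : Fin (N+2) → F | x i = a} : Finset _) with hT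
  have hdis : Disjoint T R := by
    rw [Finset.disjoint_left]
    intro x hx hx'
    exact (hR x hx').1 (by simpa [hT] using hx)
  have hcard : #(T ∪ R) = Fintype.card F ^ (N+1) + #R := by
    rw [card_union_of_disjoint hdis, hT, aux_T]
  have hsub : A (i, a, b) ∩ A (j, c, d) ⊆
      ({f : (Fin (N+2) → F) → F | ∀ x ∈ T ∪ R, f x = g x} : Finset _) := by
    intro f hf
    have hfs := (hAm _ _).1 (mem_inter.1 hf).1
    have hft := (hAm _ _).1 (mem_inter.1 hf).2
    simp only at hfs hft
    simp only [mem_filter, mem_univ, true_and]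
    intro x hx
    rcases mem_union.1 hx with hx | hx
    · have hx' : x i = a := by simpa [hT] using hx
      rw [hfs x hx', hgs x hx']
    · rw [hft x (hR x hx).2, hgt x (hR x hx).2]
  have hle := card_le_card hsub
  rw [aux_count] at hle
  have hU : #(T ∪ R) ≤ Fintype.card (Fin (N+2) → F) := card_le_univ _
  have hX : Fintype.card (Fin (N+2) → F) = Fintype.card F ^ (N+2) := by simp
  refine (Nat.mul_le_mul_right _ hle).trans ?_
  rw [← pow_add]
  apply Nat.pow_le_pow_right (by omega)
  rw [Nat.sub_mul, one_mul, ← pow_succ']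
  rw [hX] at hU ⊢
  rw [hcard] at hU ⊢
  have key : ∀ u v w r : ℕ, v + r ≤ u → w ≤ r → u - (v + r) + w ≤ u - v := by
    intro u v w r h1 h2; omega
  exact key _ _ _ _ hU hRc

open Finset in
theorem aux_main {F : Type*} [Fintype F] [DecidableEq F] [Nontrivial F] (N : ℕ) (q : ℕ)
    (hcard : Fintype.card F = q) :
    let c := Set.ncard {f : (Fin (N+2) → F) → F | ∃ (i : Fin (N+2)) (a b : F), IsCanalyzing f i a b}
    let K := (N+2) * q^2
    let M := q ^ ((q-1) * q^(N+1))
    c ≤ K * M ∧ K * M * q ^ (q ^ N) ≤ c * q ^ (q ^ N) + K * K * M := by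
  intro c K M
  let A : Fin (N+2) × F × F → Finset ((Fin (N+2) → F) → F) :=
    fun s => {f | ∀ x ∈ ({x : Fin (N+2) → F | x s.1 = s.2.1} : Finset _), f x = s.2.2}
  have hAm : ∀ s f, f ∈ A s ↔ ∀ x, x s.1 = s.2.1 → f x = s.2.2 := by
    intro s f; simp [A]
  have hA : ∀ s, #(A s) = M := by
    intro s
    have := aux_count ({x : Fin (N+2) → F | x s.1 = s.2.1} : Finset _) (fun _ => s.2.2)
    rw [aux_T] at this
    simp only [A]
    rw [this, hcard]
    simp only [M]
    congr 1
    rw [Nat.sub_mul, one_mul, ← pow_succ']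
    simp [hcard]
  have hc : c = #(univ.biUnion A) := by
    rw [← Set.ncard_coe_finset]
    simp only [c]
    congr 1
    ext f
    simp only [Set.mem_ofPred_eq, coe_biUnion, Set.mem_iUnion, mem_coe, hAm, aux_iff]
    simp [Prod.exists]
  have hK : Fintype.card (Fin (N+2) × F × F) = K := by
    simp [hcard, K, sq]
  rw [hc, ← hK]
  constructor
  · refine card_biUnion_le.trans ?_
    simp [hA]
  · apply aux_bonf A M _ hA
    intro s t hst
    have := aux_pair A hAm s t hst
    rwa [hcard] at this

theorem aux_lim (q : ℕ) (hq : 1 < q) :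
    Filter.Tendsto (fun N : ℕ => (((N+2) * q^2 : ℕ) : ℝ) / (q:ℝ) ^ (q ^ N))
      Filter.atTop (nhds 0) := by
  have h1 := tendsto_pow_const_div_const_pow_of_one_lt 1 (r := (q:ℝ)) (by exact_mod_cast hq)
  have h2 := (h1.comp (tendsto_pow_atTop_atTop_of_one_lt hq)).const_mul (3 * (q:ℝ)^2)
  rw [mul_zero] at h2
  refine squeeze_zero (fun N => by positivity) (fun N => ?_) h2
  simp only [Function.comp, pow_one]
  rw [← mul_div_assoc]
  have : N < q ^ N := Nat.lt_pow_self hq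
  have h3 : (N+2) * q^2 ≤ 3 * q^2 * q^N := by
    have : N + 2 ≤ 3 * q^N := by omega
    nlinarith [Nat.mul_le_mul_right (q^2) this]
  gcongr
  exact_mod_cast h3

theorem stmt_19 {q : ℕ} (hq : IsPrimePow q)
    (F : Type*) [Field F] [Fintype F] (hcard : Fintype.card F = q) :
    Filter.Tendsto
      (fun n : ℕ =>
        (Set.ncard {f : (Fin n → F) → F |
            ∃ (i : Fin n) (a b : F), IsCanalyzing f i a b} : ℝ) /
          ((n : ℝ) * (q : ℝ) ^ 2 * (q : ℝ) ^ ((q - 1) * q ^ (n - 1))))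
      Filter.atTop (nhds 1) := by
  classical
  have hq1 : 1 < q := hq.one_lt
  rw [← Filter.tendsto_add_atTop_iff_nat 2]
  have hlow : Filter.Tendsto (fun N : ℕ => 1 - (((N+2) * q^2 : ℕ) : ℝ) / (q:ℝ) ^ (q ^ N))
      Filter.atTop (nhds 1) := by
    simpa using (aux_lim q hq1).const_sub 1
  have hq0 : (0:ℝ) < q := by exact_mod_cast (by omega : 0 < q)
  refine tendsto_of_tendsto_of_tendsto_of_le_of_le hlow tendsto_const_nhds ?_ ?_
  · intro N
    have h := (aux_main (F := F) N q hcard).2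
    simp only at h ⊢
    rw [show N + 2 - 1 = N + 1 from rfl]
    have hR := (Nat.cast_le (α := ℝ)).2 h
    push_cast at hR ⊢
    rw [le_div_iff₀ (by positivity), sub_mul, one_mul, sub_le_iff_le_add]
    rw [div_mul_eq_mul_div, ← sub_le_iff_le_add', le_div_iff₀ (by positivity), sub_mul]
    linarith
  · intro N
    have h := (aux_main (F := F) N q hcard).1
    simp only at h ⊢
    rw [show N + 2 - 1 = N + 1 from rfl]
    have hR := (Nat.cast_le (α := ℝ)).2 h
    push_cast at hR ⊢
    exact div_le_one_of_le₀ hR (by positivity)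
end
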